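/- arXiv:math/0204312 — 5 statements merged into one kernel-verified Lean document; each statement's English description precedes it below -/
import Mathlib

section
/- Let m, n ≥ 1 be integers and let f : ℝ → ℝ be a measurable nonnegative function such that the measure on real m×(m+n) matrices with density A ↦ f(tr(A Aᵀ)) with respect to Lebesgue measure is a probability measure. Write A = (B, X), where B is the m×m matrix formed by the first m columns of A and X is the m×n matrix formed by the remaining n columns. Then the pushforward, under the (almost everywhere defined) map A ↦ B⁻¹X, of the probability measure with density A ↦ f(tr(A Aᵀ)) is the measure on real m×n matrices with density Z ↦ C · (det(1ₘ + Z Zᵀ))^(−(m+n)/2), where C = π^(−mn/2) · ∏_{j=1}^{n} Γ((m+j)/2)/Γ(j/2). In particular, this pushforward distribution is independent of the choice of f. -/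
open MeasureTheory Matrix
open scoped ENNReal Real

section Lebesgue

variable {m n p : ℕ}

theorem lintegral_mulVec {M : Matrix (Fin m) (Fin m) ℝ} (hM : M.det ≠ 0)
    {g : (Fin m → ℝ) → ℝ≥0∞} (hg : Measurable g) :
    ∫⁻ u, g (M *ᵥ u) = ENNReal.ofReal |M.det⁻¹| * ∫⁻ u, g u := by
  have h := Real.map_matrix_volume_pi_eq_smul_volume_pi hM
  have hL : Measurable (Matrix.toLin' M) := (Matrix.toLin' M).continuous_of_finiteDimensional.measurable
  rw [← smul_eq_mul, ← lintegral_smul_measure, ← h, lintegral_map hg hL]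
  rfl

theorem volume_preserving_transpose :
    MeasurePreserving (fun (Z : Fin m → Fin n → ℝ) j i => Z i j) := by
  let e : (Fin m → Fin n → ℝ) ≃L[ℝ] (Fin n → Fin m → ℝ) :=
    { toFun := fun Z j i => Z i j
      invFun := fun Z i j => Z j i
      map_add' := fun _ _ => rfl
      map_smul' := fun _ _ => rfl
      continuous_toFun := by fun_prop
      continuous_invFun := by fun_prop }
  have hc : Measurable e := e.continuous.measurable
  refine ⟨hc, ?_⟩
  change Measure.map e volume = volume
  have : (volume : Measure (Fin m → Fin n → ℝ)).IsAddHaarMeasure := Measure.pi.isAddHaarMeasure _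
  have : (volume : Measure (Fin n → Fin m → ℝ)).IsAddHaarMeasure := Measure.pi.isAddHaarMeasure _
  have : (Measure.map e volume).IsAddHaarMeasure := e.isAddHaarMeasure_map volume
  have hcube : Measure.map e volume (Set.univ.pi fun _ => Set.univ.pi fun _ => Set.Icc 0 1) = 1 := by
    rw [Measure.map_apply hc (MeasurableSet.univ_pi fun j => MeasurableSet.univ_pi fun i =>
      measurableSet_Icc)]
    have : e ⁻¹' (Set.univ.pi fun _ => Set.univ.pi fun _ => Set.Icc 0 1) =
        Set.univ.pi fun _ => Set.univ.pi fun _ => Set.Icc 0 1 := by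
      ext Z; simp only [Set.mem_preimage, Set.mem_pi, Set.mem_univ, true_imp_iff]
      exact forall_comm
    rw [this, volume_pi_pi]
    simp [Real.volume_Icc_pi]
  have h := Measure.isAddLeftInvariant_eq_smul (Measure.map e volume)
    (volume : Measure (Fin n → Fin m → ℝ))
  rw [h, Measure.smul_apply, volume_pi_pi] at hcube
  simp [Real.volume_Icc_pi, ENNReal.smul_def] at hcube
  rw [h, hcube, one_smul]

theorem lintegral_transpose {g : (Fin n → Fin m → ℝ) → ℝ≥0∞} (hg : Measurable g) :
    ∫⁻ Z : Fin m → Fin n → ℝ, g (fun j i => Z i j) = ∫⁻ Z, g Z :=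
  volume_preserving_transpose.lintegral_comp hg

theorem lintegral_mul_right {M : Matrix (Fin m) (Fin m) ℝ} (hM : M.det ≠ 0)
    {g : (Fin n → Fin m → ℝ) → ℝ≥0∞} (hg : Measurable g) :
    ∫⁻ Z : Fin n → Fin m → ℝ, g (of.symm (of Z * M)) =
      ENNReal.ofReal |M.det⁻¹| ^ n * ∫⁻ Z, g Z := by
  have hM' : Mᵀ.det ≠ 0 := by rwa [det_transpose]
  have h := Real.map_matrix_volume_pi_eq_smul_volume_pi hM'
  have hL : Measurable (Matrix.toLin' Mᵀ) :=
    (Matrix.toLin' Mᵀ).continuous_of_finiteDimensional.measurable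
  have hs : Measure.map (fun (Z : Fin n → Fin m → ℝ) i => Matrix.toLin' Mᵀ (Z i)) volume =
      ENNReal.ofReal |M.det⁻¹| ^ n • (volume : Measure (Fin n → Fin m → ℝ)) := by
    have hσ : SigmaFinite (Measure.map (Matrix.toLin' Mᵀ) (volume : Measure (Fin m → ℝ))) := by
      rw [h, ENNReal.ofReal]
      change SigmaFinite (|Mᵀ.det⁻¹|.toNNReal • (volume : Measure (Fin m → ℝ)))
      infer_instance
    rw [volume_pi, Measure.pi_map_pi (hμ := fun _ => hσ) (fun _ => hL.aemeasurable)]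
    refine Measure.pi_eq fun s hs => ?_
    simp only [h, det_transpose]
    simp [Finset.prod_mul_distrib]
  rw [← smul_eq_mul, ← lintegral_smul_measure, ← hs, lintegral_map hg (by fun_prop)]
  refine lintegral_congr fun Z => ?_
  congr 1
  ext i j
  simp [Matrix.mul_apply, Matrix.mulVec, dotProduct, mul_comm]

theorem lintegral_mul_left {M : Matrix (Fin m) (Fin m) ℝ} (hM : M.det ≠ 0)
    {g : (Fin m → Fin n → ℝ) → ℝ≥0∞} (hg : Measurable g) :
    ∫⁻ Z : Fin m → Fin n → ℝ, g (of.symm (M * of Z)) =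
      ENNReal.ofReal |M.det⁻¹| ^ n * ∫⁻ Z, g Z := by
  have hM' : Mᵀ.det ≠ 0 := by rwa [det_transpose]
  have hg' : Measurable fun Z : Fin n → Fin m → ℝ => g (fun j i => Z i j) :=
    hg.comp (by fun_prop)
  rw [← lintegral_transpose hg, ← det_transpose M, ← lintegral_mul_right hM' hg',
    ← lintegral_transpose]
  · refine lintegral_congr fun Z => ?_
    congr 1
    ext i j
    simp [Matrix.mul_apply, mul_comm]
  · refine hg'.comp (measurable_pi_lambda _ fun j => measurable_pi_lambda _ fun i => ?_)
    simp only [of_symm_apply, mul_apply, of_apply]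
    fun_prop

theorem volume_preserving_splitFun :
    MeasurePreserving (fun f : Fin (n + p) → ℝ =>
      ((fun j => f (Fin.castAdd p j), fun j => f (Fin.natAdd n j)) :
        (Fin n → ℝ) × (Fin p → ℝ))) :=
  (volume_measurePreserving_sumPiEquivProdPi fun _ : Fin n ⊕ Fin p => ℝ).comp
    ((volume_measurePreserving_piCongrLeft (fun _ : Fin (n + p) => ℝ) finSumFinEquiv).symm _)

theorem lintegral_splitCols {g : (Fin m → Fin (n + p) → ℝ) → ℝ≥0∞} (hg : Measurable g) :
    ∫⁻ A, g A = ∫⁻ B : Fin m → Fin n → ℝ, ∫⁻ X : Fin m → Fin p → ℝ,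
      g (fun i => Fin.append (B i) (X i)) := by
  have happ : Measurable fun q : (Fin m → Fin n → ℝ) × (Fin m → Fin p → ℝ) =>
      (fun i => Fin.append (q.1 i) (q.2 i) : Fin m → Fin (n + p) → ℝ) := by
    refine measurable_pi_lambda _ fun i => measurable_pi_lambda _ fun j => ?_
    refine Fin.addCases (fun j => ?_) (fun j => ?_) j
    · simp only [Fin.append_left]; fun_prop
    · simp only [Fin.append_right]; fun_prop
  have h := (volume_measurePreserving_arrowProdEquivProdArrow (Fin n → ℝ) (Fin p → ℝ) (Fin m)).comp
    (volume_preserving_pi fun _ : Fin m => volume_preserving_splitFun (n := n) (p := p))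
  rw [← lintegral_prod (fun q : (Fin m → Fin n → ℝ) × (Fin m → Fin p → ℝ) =>
    g (fun i => Fin.append (q.1 i) (q.2 i))) (hg.comp happ).aemeasurable,
    ← Measure.volume_eq_prod]
  refine Eq.trans ?_ (h.lintegral_comp (hg.comp happ))
  refine lintegral_congr fun A => ?_
  congr 1
  ext i j
  refine Fin.addCases (fun j => ?_) (fun j => ?_) j
  · rw [Fin.append_left]; rfl
  · rw [Fin.append_right]; rfl

theorem ae_det_ne_zero : ∀ᵐ B : Fin m → Fin m → ℝ, (of B).det ≠ 0 := by
  have hdet : Continuous fun B : Fin m → Fin m → ℝ => (of B).det :=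
    Continuous.matrix_det (continuous_id)
  set S : Set (Fin m → Fin m → ℝ) := {B | (of B).det = 0} with hS
  have hSm : MeasurableSet S := (isClosed_singleton.preimage hdet).measurableSet
  have hshift : Continuous fun q : (Fin m → Fin m → ℝ) × ℝ =>
      q.1 + q.2 • (fun i j => (1 : Matrix (Fin m) (Fin m) ℝ) i j) := by fun_prop
  have h1 : ∀ B : Fin m → Fin m → ℝ,
      ∫⁻ t : ℝ, S.indicator 1 (B + t • fun i j => (1 : Matrix (Fin m) (Fin m) ℝ) i j) = 0 := by
    intro B
    have hfin : {t : ℝ | (B + t • fun i j => (1 : Matrix (Fin m) (Fin m) ℝ) i j) ∈ S}.Finite := by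
      refine ((-of B).charpoly.roots.toFinset.finite_toSet).subset fun t ht => ?_
      simp only [Finset.mem_coe, Multiset.mem_toFinset]
      rw [Polynomial.mem_roots (charpoly_monic _).ne_zero, Polynomial.IsRoot, eval_charpoly]
      have ht : (of (B + t • fun i j => (1 : Matrix (Fin m) (Fin m) ℝ) i j)).det = 0 := ht
      rw [← ht]
      congr 1
      ext i j
      simp [Matrix.one_apply, Matrix.diagonal_apply, add_comm]
    rw [lintegral_eq_zero_iff' ]
    · have := hfin.measure_zero volume
      rw [measure_eq_zero_iff_ae_notMem] at this
      filter_upwards [this] with t ht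
      exact Set.indicator_of_notMem ht _
    · refine Measurable.aemeasurable ?_
      exact (measurable_one.indicator hSm).comp (by fun_prop)
  have h2 : ∫⁻ t : ℝ, ∫⁻ B : Fin m → Fin m → ℝ,
      S.indicator 1 (B + t • fun i j => (1 : Matrix (Fin m) (Fin m) ℝ) i j) = 0 := by
    rw [lintegral_lintegral_swap]
    · simp [h1]
    · exact ((measurable_one.indicator hSm).comp (hshift.measurable.comp measurable_swap)).aemeasurable
  have h3 : ∀ t : ℝ, ∫⁻ B : Fin m → Fin m → ℝ,
      S.indicator 1 (B + t • fun i j => (1 : Matrix (Fin m) (Fin m) ℝ) i j) = volume S := by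
    intro t
    rw [lintegral_add_right_eq_self (fun B => S.indicator 1 B), lintegral_indicator_one hSm]
  simp_rw [h3] at h2
  simp at h2
  rw [ae_iff]
  simpa [hS] using h2

theorem Matrix.PosDef.exists_eq_mul_transpose {W : Matrix (Fin m) (Fin m) ℝ} (hW : W.PosDef) :
    ∃ L : Matrix (Fin m) (Fin m) ℝ, L.det ≠ 0 ∧ W = L * Lᵀ := by
  open scoped MatrixOrder in
  obtain ⟨L, rfl⟩ := CStarAlgebra.nonneg_iff_eq_star_mul_self.mp hW.posSemidef.nonneg
  refine ⟨Lᵀ, fun h => hW.det_pos.ne' ?_, ?_⟩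
  · rw [det_transpose] at h; simp [h]
  · simp [star_eq_conjTranspose, conjTranspose_eq_transpose_of_trivial]

theorem lintegral_one_add_dotProduct_rpow {s : ℝ} (hs : (m : ℝ) / 2 < s) :
    ∫⁻ u : Fin m → ℝ, ENNReal.ofReal ((1 + u ⬝ᵥ u) ^ (-s)) =
      ENNReal.ofReal (π ^ ((m : ℝ) / 2) * (Real.Gamma (s - m / 2) / Real.Gamma s)) := by
  have hs0 : 0 < s := lt_of_le_of_lt (by positivity) hs
  have hG := Real.Gamma_pos_of_pos hs0
  have hgam : ∀ a r : ℝ, 0 < a → 0 < r →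
      ∫⁻ t in Set.Ioi (0 : ℝ), ENNReal.ofReal (t ^ (a - 1) * Real.exp (-(r * t))) =
        ENNReal.ofReal ((1 / r) ^ a * Real.Gamma a) := by
    intro a r ha hr
    have h := Real.integral_rpow_mul_exp_neg_mul_Ioi ha hr
    have hpos : 0 < (1 / r) ^ a * Real.Gamma a :=
      mul_pos (Real.rpow_pos_of_pos (by positivity) _) (Real.Gamma_pos_of_pos ha)
    rw [← h, ofReal_integral_eq_lintegral_ofReal]
    · exact not_imp_comm.1 integral_undef (h ▸ hpos.ne')
    · filter_upwards [ae_restrict_mem measurableSet_Ioi] with t ht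
      exact mul_nonneg (Real.rpow_nonneg (le_of_lt ht) _) (Real.exp_pos _).le
  have hgauss : ∀ t : ℝ, 0 < t →
      ∫⁻ u : Fin m → ℝ, ENNReal.ofReal (Real.exp (-(t * (u ⬝ᵥ u)))) =
        ENNReal.ofReal ((π / t) ^ ((m : ℝ) / 2)) := by
    intro t ht
    have h := integral_fintype_prod_volume_eq_pow (ι := Fin m)
      (fun x : ℝ => Real.exp (-t * x ^ 2))
    have e : ∀ u : Fin m → ℝ, ∏ i, Real.exp (-t * u i ^ 2) = Real.exp (-(t * (u ⬝ᵥ u))) := by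
      intro u
      rw [← Real.exp_sum, dotProduct, ← neg_mul, Finset.mul_sum]
      simp_rw [sq]
    simp_rw [e, integral_gaussian] at h
    have hpt : 0 < π / t := by positivity
    have h2 : √(π / t) ^ Fintype.card (Fin m) = (π / t) ^ ((m : ℝ) / 2) := by
      rw [Real.sqrt_eq_rpow, ← Real.rpow_natCast, ← Real.rpow_mul hpt.le]
      simp; ring_nf
    rw [h2] at h
    rw [← h, ofReal_integral_eq_lintegral_ofReal]
    · exact not_imp_comm.1 integral_undef (h ▸ (Real.rpow_pos_of_pos hpt _).ne')
    · exact Filter.Eventually.of_forall fun u => (Real.exp_pos _).le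
  have hdot : ∀ u : Fin m → ℝ, 0 ≤ u ⬝ᵥ u := fun u => by
    simpa using dotProduct_star_self_nonneg u
  have h1 : ENNReal.ofReal (Real.Gamma s) *
      ∫⁻ u : Fin m → ℝ, ENNReal.ofReal ((1 + u ⬝ᵥ u) ^ (-s)) =
      ENNReal.ofReal (π ^ ((m : ℝ) / 2) * Real.Gamma (s - m / 2)) := by
    have hmd : Measurable fun u : Fin m → ℝ => u ⬝ᵥ u := by unfold dotProduct; fun_prop
    calc _ = ∫⁻ u : Fin m → ℝ, ∫⁻ t in Set.Ioi (0 : ℝ),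
          ENNReal.ofReal (t ^ (s - 1) * Real.exp (-((1 + u ⬝ᵥ u) * t))) := by
          rw [← lintegral_const_mul _ (by fun_prop)]
          refine lintegral_congr fun u => ?_
          have := hdot u
          rw [hgam s _ hs0 (by positivity), ← ENNReal.ofReal_mul hG.le, mul_comm, one_div,
            Real.inv_rpow (by positivity), Real.rpow_neg (by positivity)]
      _ = ∫⁻ t in Set.Ioi (0 : ℝ), ∫⁻ u : Fin m → ℝ,
          ENNReal.ofReal (t ^ (s - 1) * Real.exp (-((1 + u ⬝ᵥ u) * t))) := by
          rw [lintegral_lintegral_swap]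
          apply Measurable.aemeasurable
          unfold Function.uncurry
          have : Measurable fun p : (Fin m → ℝ) × ℝ => p.1 ⬝ᵥ p.1 := hmd.comp measurable_fst
          fun_prop
      _ = ∫⁻ t in Set.Ioi (0 : ℝ), ENNReal.ofReal (π ^ ((m : ℝ) / 2)) *
          ENNReal.ofReal (t ^ (s - m / 2 - 1) * Real.exp (-(1 * t))) := by
          refine setLIntegral_congr_fun measurableSet_Ioi fun t ht => ?_
          have ht : 0 < t := ht
          have e : ∀ u : Fin m → ℝ,
              ENNReal.ofReal (t ^ (s - 1) * Real.exp (-((1 + u ⬝ᵥ u) * t))) =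
              ENNReal.ofReal (t ^ (s - 1) * Real.exp (-t)) *
                ENNReal.ofReal (Real.exp (-(t * (u ⬝ᵥ u)))) := by
            intro u
            rw [← ENNReal.ofReal_mul (by positivity), mul_assoc, ← Real.exp_add]
            ring_nf
          simp_rw [e]
          rw [lintegral_const_mul _ (by fun_prop), hgauss t ht,
            ← ENNReal.ofReal_mul (by positivity), ← ENNReal.ofReal_mul (by positivity)]
          congr 1
          rw [Real.div_rpow Real.pi_pos.le ht.le,
            show s - (m : ℝ) / 2 - 1 = (s - 1) - (m : ℝ) / 2 by ring, Real.rpow_sub ht (s - 1) (m / 2), one_mul]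
          ring
      _ = _ := by
          rw [lintegral_const_mul _ (by fun_prop), hgam _ _ (by linarith) one_pos,
            ← ENNReal.ofReal_mul (by positivity)]
          simp
  have hG0 : ENNReal.ofReal (Real.Gamma s) ≠ 0 := by simpa using hG
  rw [← ENNReal.mul_right_inj hG0 ENNReal.ofReal_ne_top, h1, ← ENNReal.ofReal_mul hG.le]
  congr 1
  field_simp

theorem measurable_matrix_det_comp {α : Type*} [MeasurableSpace α]
    {M : α → Matrix (Fin m) (Fin m) ℝ} (hM : ∀ i j, Measurable fun a => M a i j) :
    Measurable fun a => (M a).det := by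
  simp only [det_apply]
  exact Finset.measurable_fun_sum _ fun σ _ =>
    (Finset.measurable_fun_prod _ fun i _ => hM _ _).const_smul _

theorem Matrix.posDef_one_add_mul_transpose (Z : Matrix (Fin m) (Fin n) ℝ) :
    (1 + Z * Zᵀ).PosDef := by
  have h := posSemidef_self_mul_conjTranspose Z
  rw [conjTranspose_eq_transpose_of_trivial] at h
  exact PosDef.one.add_posSemidef h

theorem lintegral_det_add_vecMulVec_rpow {W : Matrix (Fin m) (Fin m) ℝ} (hW : W.PosDef) {s : ℝ}
    (hs : (m : ℝ) / 2 < s) :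
    ∫⁻ y, ENNReal.ofReal ((W + vecMulVec y y).det ^ (-s)) =
      ENNReal.ofReal (W.det ^ (-s + 1 / 2)) *
        ENNReal.ofReal (π ^ ((m : ℝ) / 2) * (Real.Gamma (s - m / 2) / Real.Gamma s)) := by
  obtain ⟨L, hL, rfl⟩ := hW.exists_eq_mul_transpose
  have hg : Measurable fun y : Fin m → ℝ =>
      ENNReal.ofReal ((L * Lᵀ + vecMulVec y y).det ^ (-s)) := by
    refine ((measurable_matrix_det_comp fun i j => ?_).pow_const _).ennreal_ofReal
    simp only [Matrix.add_apply, vecMulVec_apply]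
    fun_prop
  have h := lintegral_mulVec hL hg
  have hL2 : 0 < L.det ^ 2 := by positivity
  have e : ∀ u : Fin m → ℝ,
      ENNReal.ofReal ((L * Lᵀ + vecMulVec (L *ᵥ u) (L *ᵥ u)).det ^ (-s)) =
      ENNReal.ofReal ((L.det ^ 2) ^ (-s)) * ENNReal.ofReal ((1 + u ⬝ᵥ u) ^ (-s)) := by
    intro u
    have hu : 0 ≤ u ⬝ᵥ u := by simpa using dotProduct_star_self_nonneg u
    have : L * Lᵀ + vecMulVec (L *ᵥ u) (L *ᵥ u) =
        L * (1 + replicateCol Unit u * replicateRow Unit u) * Lᵀ := by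
      rw [← vecMulVec_eq, mul_add, add_mul, mul_one, mul_vecMulVec, vecMulVec_mul,
        vecMul_transpose]
    rw [this, det_mul, det_mul, det_transpose, det_one_add_replicateCol_mul_replicateRow,
      ← ENNReal.ofReal_mul (by positivity), ← Real.mul_rpow (by positivity) (by positivity)]
    congr 2
    ring
  simp_rw [e] at h
  rw [lintegral_const_mul' _ _ ENNReal.ofReal_ne_top, lintegral_one_add_dotProduct_rpow hs] at h
  have hA : 0 < |L.det| := abs_pos.2 hL
  have hc : ENNReal.ofReal |L.det⁻¹| ≠ 0 := by simpa [abs_inv] using hL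
  rw [← ENNReal.mul_right_inj hc ENNReal.ofReal_ne_top, ← h, ← mul_assoc,
    ← ENNReal.ofReal_mul (abs_nonneg _)]
  congr 2
  rw [det_mul, det_transpose, ← sq, abs_inv, ← sq_abs, Real.rpow_add (by positivity),
    ← Real.sqrt_eq_rpow, Real.sqrt_sq hA.le]
  field_simp

theorem lintegral_det_one_add_transpose_mul_rpow (m n : ℕ) :
    ∫⁻ Y : Fin n → Fin m → ℝ,
        ENNReal.ofReal ((1 + (of Y)ᵀ * of Y).det ^ (-((m : ℝ) + n) / 2)) =
      ENNReal.ofReal (∏ j ∈ Finset.range n, π ^ ((m : ℝ) / 2) *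
        (Real.Gamma (((j + 1) : ℝ) / 2) / Real.Gamma ((m + (j + 1) : ℝ) / 2))) := by
  induction n with
  | zero => simp [volume_pi]
  | succ n ih =>
    have hcons : ∀ (y : Fin m → ℝ) (Y : Fin n → Fin m → ℝ),
        1 + (of (Fin.cons y Y : Fin (n + 1) → Fin m → ℝ))ᵀ * of (Fin.cons y Y) =
          (1 + (of Y)ᵀ * of Y) + vecMulVec y y := by
      intro y Y
      ext i j
      simp [mul_apply, Fin.sum_univ_succ, vecMulVec_apply]
      ring
    have hmeas : Measurable fun q : (Fin m → ℝ) × (Fin n → Fin m → ℝ) =>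
        ENNReal.ofReal (((1 + (of q.2)ᵀ * of q.2) + vecMulVec q.1 q.1).det ^
          (-((m : ℝ) + (n + 1 : ℕ)) / 2)) := by
      refine ((measurable_matrix_det_comp fun i j => ?_).pow_const _).ennreal_ofReal
      simp only [Matrix.add_apply, vecMulVec_apply, mul_apply, transpose_apply, of_apply]
      fun_prop
    have hs : (m : ℝ) / 2 < (m + (n + 1)) / 2 := by linarith [Nat.cast_nonneg (α := ℝ) n]
    rw [((volume_preserving_piFinSuccAbove
      (fun _ : Fin (n + 1) => Fin m → ℝ) 0).symm _).lintegral_map_equiv]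
    calc _ = ∫⁻ q : (Fin m → ℝ) × (Fin n → Fin m → ℝ),
          ENNReal.ofReal (((1 + (of q.2)ᵀ * of q.2) + vecMulVec q.1 q.1).det ^
            (-((m : ℝ) + (n + 1 : ℕ)) / 2)) := by
          refine lintegral_congr fun q => ?_
          rw [← hcons]
          congr 4; simp [MeasurableEquiv.piFinSuccAbove, Fin.consEquiv]
      _ = ∫⁻ Y : Fin n → Fin m → ℝ, ∫⁻ y : Fin m → ℝ,
          ENNReal.ofReal (((1 + (of Y)ᵀ * of Y) + vecMulVec y y).det ^
            (-((m + (n + 1)) / 2 : ℝ))) := by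
          rw [Measure.volume_eq_prod, lintegral_prod_symm _ hmeas.aemeasurable]
          push_cast
          simp_rw [neg_div]
      _ = ∫⁻ Y : Fin n → Fin m → ℝ,
          ENNReal.ofReal ((1 + (of Y)ᵀ * of Y).det ^ (-((m : ℝ) + n) / 2)) *
          ENNReal.ofReal (π ^ ((m : ℝ) / 2) *
            (Real.Gamma (((n + 1) : ℝ) / 2) / Real.Gamma ((m + (n + 1) : ℝ) / 2))) := by
          refine lintegral_congr fun Y => ?_
          have hW := posDef_one_add_mul_transpose (of Y)ᵀ
          rw [transpose_transpose] at hW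
          rw [lintegral_det_add_vecMulVec_rpow hW hs]
          ring_nf
      _ = _ := by
          rw [lintegral_mul_const' _ _ ENNReal.ofReal_ne_top, ih, Finset.prod_range_succ,
            ← ENNReal.ofReal_mul]
          exact Finset.prod_nonneg fun j _ => by positivity

theorem lintegral_det_one_add_mul_transpose_rpow (m n : ℕ) :
    ∫⁻ Z : Fin m → Fin n → ℝ,
        ENNReal.ofReal ((1 + of Z * (of Z)ᵀ).det ^ (-((m : ℝ) + n) / 2)) =
      ENNReal.ofReal (∏ j ∈ Finset.range n, π ^ ((m : ℝ) / 2) *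
        (Real.Gamma (((j + 1) : ℝ) / 2) / Real.Gamma ((m + (j + 1) : ℝ) / 2))) := by
  rw [← lintegral_det_one_add_transpose_mul_rpow, ← lintegral_transpose]
  · rfl
  · refine ((measurable_matrix_det_comp fun i j => ?_).pow_const _).ennreal_ofReal
    simp only [Matrix.add_apply, mul_apply, transpose_apply, of_apply]
    fun_prop

theorem lintegral_det_pow_mul_trace {W : Matrix (Fin m) (Fin m) ℝ} (hW : W.PosDef)
    {f : ℝ → ℝ≥0∞} (hf : Measurable f) (n : ℕ) :
    ∫⁻ B : Fin m → Fin m → ℝ,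
        ENNReal.ofReal |(of B).det| ^ n * f (of B * W * (of B)ᵀ).trace =
      ENNReal.ofReal (W.det ^ (-((m : ℝ) + n) / 2)) *
        ∫⁻ B : Fin m → Fin m → ℝ,
          ENNReal.ofReal |(of B).det| ^ n * f (of B * (of B)ᵀ).trace := by
  obtain ⟨L, hL, rfl⟩ := hW.exists_eq_mul_transpose
  have hg : Measurable fun B : Fin m → Fin m → ℝ =>
      ENNReal.ofReal |(of B).det| ^ n * f (of B * (of B)ᵀ).trace := by
    refine Measurable.mul ?_ (hf.comp ?_)
    · have := measurable_matrix_det_comp (M := fun B : Fin m → Fin m → ℝ => of B)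
        fun i j => by simp only [of_apply]; fun_prop
      exact (this.abs.ennreal_ofReal).pow_const _
    · simp only [trace, diag_apply, mul_apply, transpose_apply, of_apply]
      fun_prop
  have h := lintegral_mul_right hL hg
  have hA : 0 < |L.det| := abs_pos.2 hL
  have e : ∀ B : Fin m → Fin m → ℝ,
      ENNReal.ofReal |(of (of.symm (of B * L))).det| ^ n *
        f (of (of.symm (of B * L)) * (of (of.symm (of B * L)))ᵀ).trace =
      ENNReal.ofReal |L.det| ^ n *
        (ENNReal.ofReal |(of B).det| ^ n * f (of B * (L * Lᵀ) * (of B)ᵀ).trace) := by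
    intro B
    simp only [Equiv.apply_symm_apply, det_mul, abs_mul, transpose_mul, Matrix.mul_assoc]
    rw [ENNReal.ofReal_mul (abs_nonneg _), mul_pow]
    ring
  simp_rw [e] at h
  rw [lintegral_const_mul' _ _ (ENNReal.pow_ne_top ENNReal.ofReal_ne_top)] at h
  have hc : ENNReal.ofReal |L.det| ^ n ≠ 0 := pow_ne_zero _ (by simpa using hL)
  rw [← ENNReal.mul_right_inj hc (ENNReal.pow_ne_top ENNReal.ofReal_ne_top), h, ← mul_assoc,
    ← ENNReal.ofReal_pow (abs_nonneg _), ← ENNReal.ofReal_pow (abs_nonneg _),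
    ← ENNReal.ofReal_mul (by positivity)]
  congr 2
  rw [det_mul, det_transpose, ← sq, ← sq_abs, abs_inv, ← Real.rpow_natCast |L.det| 2,
    ← Real.rpow_mul hA.le,
    show ((2 : ℕ) : ℝ) * (-((m : ℝ) + n) / 2) = -(n : ℝ) - m by push_cast; ring,
    Real.rpow_sub hA, Real.rpow_neg hA.le, Real.rpow_natCast, Real.rpow_natCast]
  field_simp
  rw [one_div, inv_pow, inv_mul_cancel₀ (by positivity)]

theorem measurable_inv_mul_cols {n : ℕ} :
    Measurable fun A : Fin m → Fin (m + n) → ℝ =>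
      of.symm (((of A).submatrix id (Fin.castAdd n))⁻¹ *
        (of A).submatrix id (Fin.natAdd m)) := by
  refine measurable_pi_lambda _ fun i => measurable_pi_lambda _ fun j => ?_
  simp only [of_symm_apply, mul_apply, inv_def, Ring.inverse_eq_inv', Matrix.smul_apply,
    adjugate_apply, submatrix_apply, of_apply, id_eq, smul_eq_mul]
  refine Finset.measurable_fun_sum _ fun k _ => Measurable.mul (Measurable.mul ?_ ?_) (by fun_prop)
  · refine (measurable_matrix_det_comp fun a b => ?_).inv
    simp only [submatrix_apply, of_apply, id_eq]
    fun_prop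
  · refine measurable_matrix_det_comp fun a b => ?_
    simp only [updateRow_apply]
    split_ifs
    · fun_prop
    · simp only [submatrix_apply, of_apply, id_eq]
      fun_prop

theorem measurable_trace_mul_one_add_mul {α : Type*} [MeasurableSpace α]
    {B : α → Fin m → Fin m → ℝ} {Z : α → Fin m → Fin n → ℝ} (hB : Measurable B)
    (hZ : Measurable Z) :
    Measurable fun a => (of (B a) * (1 + of (Z a) * (of (Z a))ᵀ) * (of (B a))ᵀ).trace := by
  simp only [trace, diag_apply, mul_apply, transpose_apply, of_apply, Matrix.add_apply]
  fun_prop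

theorem lintegral_trace_inv_mul_cols {f : ℝ → ℝ≥0∞} (hf : Measurable f)
    {φ : (Fin m → Fin n → ℝ) → ℝ≥0∞} (hφ : Measurable φ) :
    ∫⁻ A : Fin m → Fin (m + n) → ℝ,
        φ (of.symm (((of A).submatrix id (Fin.castAdd n))⁻¹ *
          (of A).submatrix id (Fin.natAdd m))) * f (of A * (of A)ᵀ).trace =
      (∫⁻ B : Fin m → Fin m → ℝ, ENNReal.ofReal |(of B).det| ^ n * f (of B * (of B)ᵀ).trace) *
        ∫⁻ Z : Fin m → Fin n → ℝ,
          φ Z * ENNReal.ofReal ((1 + of Z * (of Z)ᵀ).det ^ (-((m : ℝ) + n) / 2)) := by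
  have htr : Measurable fun A : Fin m → Fin (m + n) → ℝ => f (of A * (of A)ᵀ).trace := by
    refine hf.comp ?_
    simp only [trace, diag_apply, mul_apply, transpose_apply, of_apply]
    fun_prop
  have hdet : Measurable fun B : Fin m → Fin m → ℝ => (of B).det :=
    measurable_matrix_det_comp fun i j => by simp only [of_apply]; fun_prop
  have hW : Measurable fun Z : Fin m → Fin n → ℝ =>
      ENNReal.ofReal ((1 + of Z * (of Z)ᵀ).det ^ (-((m : ℝ) + n) / 2)) := by
    refine ((measurable_matrix_det_comp fun i j => ?_).pow_const _).ennreal_ofReal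
    simp only [Matrix.add_apply, mul_apply, transpose_apply, of_apply]
    fun_prop
  have hcols : ∀ (B : Fin m → Fin m → ℝ) (X : Fin m → Fin n → ℝ),
      (of fun i => Fin.append (B i) (X i)).submatrix id (Fin.castAdd n) = of B ∧
      (of fun i => Fin.append (B i) (X i)).submatrix id (Fin.natAdd m) = of X ∧
      (of (fun i => Fin.append (B i) (X i)) * (of fun i => Fin.append (B i) (X i))ᵀ) =
        of B * (of B)ᵀ + of X * (of X)ᵀ := by
    intro B X
    refine ⟨by ext; simp, by ext; simp, ?_⟩
    ext i j
    simp [mul_apply, Fin.sum_univ_add]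
  rw [lintegral_splitCols (g := fun A => φ (of.symm (((of A).submatrix id (Fin.castAdd n))⁻¹ *
    (of A).submatrix id (Fin.natAdd m))) * f (of A * (of A)ᵀ).trace)
    ((hφ.comp measurable_inv_mul_cols).mul htr)]
  simp only [(hcols _ _).1, (hcols _ _).2.1, (hcols _ _).2.2]
  have hinner : ∀ B : Fin m → Fin m → ℝ, (of B).det ≠ 0 →
      ∫⁻ X : Fin m → Fin n → ℝ,
        φ (of.symm ((of B)⁻¹ * of X)) * f (of B * (of B)ᵀ + of X * (of X)ᵀ).trace =
      ∫⁻ Z : Fin m → Fin n → ℝ, ENNReal.ofReal |(of B).det| ^ n *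
        (φ Z * f (of B * (1 + of Z * (of Z)ᵀ) * (of B)ᵀ).trace) := by
    intro B hB
    have hinv : (of B)⁻¹.det ≠ 0 := by
      rw [det_nonsing_inv, Ring.inverse_eq_inv']; exact inv_ne_zero hB
    have hunit : IsUnit (of B).det := isUnit_iff_ne_zero.2 hB
    have hg : Measurable fun Z : Fin m → Fin n → ℝ =>
        φ Z * f (of B * (1 + of Z * (of Z)ᵀ) * (of B)ᵀ).trace :=
      hφ.mul (hf.comp (measurable_trace_mul_one_add_mul measurable_const measurable_id))
    have h := lintegral_mul_left hinv hg
    rw [det_nonsing_inv, Ring.inverse_eq_inv', inv_inv] at h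
    rw [lintegral_const_mul _ hg, ← h]
    have hquad : ∀ X : Matrix (Fin m) (Fin n) ℝ,
        of B * (1 + ((of B)⁻¹ * X) * ((of B)⁻¹ * X)ᵀ) * (of B)ᵀ =
          of B * (of B)ᵀ + X * Xᵀ := by
      intro X
      have hX : of B * ((of B)⁻¹ * X) = X := by
        rw [← Matrix.mul_assoc, mul_nonsing_inv _ hunit, Matrix.one_mul]
      rw [Matrix.mul_add, Matrix.add_mul, Matrix.mul_one, ← Matrix.mul_assoc, hX,
        Matrix.mul_assoc, ← transpose_mul, hX]
    simp only [Equiv.apply_symm_apply, hquad]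
  calc _ = ∫⁻ B : Fin m → Fin m → ℝ, ∫⁻ Z : Fin m → Fin n → ℝ,
        ENNReal.ofReal |(of B).det| ^ n *
          (φ Z * f (of B * (1 + of Z * (of Z)ᵀ) * (of B)ᵀ).trace) :=
        lintegral_congr_ae (ae_det_ne_zero.mono hinner)
    _ = ∫⁻ Z : Fin m → Fin n → ℝ, ∫⁻ B : Fin m → Fin m → ℝ,
        ENNReal.ofReal |(of B).det| ^ n *
          (φ Z * f (of B * (1 + of Z * (of Z)ᵀ) * (of B)ᵀ).trace) := by
        rw [lintegral_lintegral_swap]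
        refine Measurable.aemeasurable ?_
        exact ((hdet.comp measurable_fst).abs.ennreal_ofReal.pow_const n).mul
          ((hφ.comp measurable_snd).mul
            (hf.comp (measurable_trace_mul_one_add_mul measurable_fst measurable_snd)))
    _ = ∫⁻ Z : Fin m → Fin n → ℝ, (∫⁻ B : Fin m → Fin m → ℝ,
        ENNReal.ofReal |(of B).det| ^ n * f (of B * (of B)ᵀ).trace) *
          (φ Z * ENNReal.ofReal ((1 + of Z * (of Z)ᵀ).det ^ (-((m : ℝ) + n) / 2))) := by
        refine lintegral_congr fun Z => ?_
        simp_rw [mul_left_comm _ (φ Z)]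
        rw [lintegral_const_mul, lintegral_det_pow_mul_trace (posDef_one_add_mul_transpose _) hf,
          mul_comm (ENNReal.ofReal _)]
        exact (hdet.abs.ennreal_ofReal.pow_const n).mul
          (hf.comp (measurable_trace_mul_one_add_mul measurable_id measurable_const))
    _ = _ := by
        have hφW : Measurable fun Z : Fin m → Fin n → ℝ =>
            φ Z * ENNReal.ofReal ((1 + of Z * (of Z)ᵀ).det ^ (-((m : ℝ) + n) / 2)) := hφ.mul hW
        rw [lintegral_const_mul _ hφW]

end Lebesgue

/-- **Universality of the distribution of `B⁻¹X` for real random matrices.**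
If `A` is an `m × (m+n)` real random matrix with probability density
`A ↦ f(tr A Aᵀ)` w.r.t. Lebesgue measure, and `A = (B, X)` with `B` the first
`m` columns and `X` the remaining `n` columns, then `Z = B⁻¹X` has density
`C · det(1 + Z Zᵀ)^(-(m+n)/2)` with `C = π^(-mn/2) ∏_{j=1}^n Γ((m+j)/2)/Γ(j/2)`,
independently of `f`. -/
theorem universality_real_Binv_X (m n : ℕ) (hm : 1 ≤ m) (hn : 1 ≤ n)
    (f : ℝ → ℝ) (hf_meas : Measurable f) (hf_nonneg : ∀ x, 0 ≤ f x)
    (μ : Measure (Fin m → Fin (m + n) → ℝ))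
    (hμ : μ = volume.withDensity fun A =>
      ENNReal.ofReal (f (Matrix.trace (Matrix.of A * (Matrix.of A)ᵀ))))
    (hprob : IsProbabilityMeasure μ) :
    μ.map (fun A : Fin m → Fin (m + n) → ℝ =>
        Matrix.of.symm
          (((Matrix.of A).submatrix id (Fin.castAdd n))⁻¹ *
            (Matrix.of A).submatrix id (Fin.natAdd m)))
      = volume.withDensity fun Z : Fin m → Fin n → ℝ =>
          ENNReal.ofReal
            ((Real.pi ^ (-(m * n : ℝ) / 2) *
                ∏ j ∈ Finset.range n,
                  Real.Gamma ((m + (j + 1) : ℝ) / 2) / Real.Gamma (((j + 1) : ℝ) / 2)) *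
              Matrix.det (1 + Matrix.of Z * (Matrix.of Z)ᵀ) ^ (-((m : ℝ) + n) / 2)) := by
  set c : ℝ := Real.pi ^ (-(m * n : ℝ) / 2) * ∏ j ∈ Finset.range n,
    Real.Gamma ((m + (j + 1) : ℝ) / 2) / Real.Gamma (((j + 1) : ℝ) / 2) with hc
  have hf : Measurable fun x => ENNReal.ofReal (f x) := hf_meas.ennreal_ofReal
  have hcpos : 0 < c := mul_pos (Real.rpow_pos_of_pos Real.pi_pos _)
    (Finset.prod_pos fun j _ => div_pos (Real.Gamma_pos_of_pos (by positivity))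
      (Real.Gamma_pos_of_pos (by positivity)))
  have hI : ∏ j ∈ Finset.range n, π ^ ((m : ℝ) / 2) *
      (Real.Gamma (((j + 1) : ℝ) / 2) / Real.Gamma ((m + (j + 1) : ℝ) / 2)) = c⁻¹ := by
    rw [hc, Finset.prod_mul_distrib, Finset.prod_const, Finset.card_range, mul_inv,
      ← Finset.prod_inv_distrib, neg_div, Real.rpow_neg Real.pi_pos.le, inv_inv,
      ← Real.rpow_mul_natCast Real.pi_pos.le]
    simp_rw [inv_div]
    congr 2
    ring
  have hK : ∫⁻ B : Fin m → Fin m → ℝ, ENNReal.ofReal |(of B).det| ^ n *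
      ENNReal.ofReal (f (of B * (of B)ᵀ).trace) = ENNReal.ofReal c := by
    have h := lintegral_trace_inv_mul_cols (m := m) (n := n) hf (φ := 1) measurable_one
    simp only [Pi.one_apply, one_mul] at h
    rw [lintegral_det_one_add_mul_transpose_rpow, hI, ← setLIntegral_univ,
      ← withDensity_apply _ MeasurableSet.univ, ← hμ, measure_univ,
      ENNReal.ofReal_inv_of_pos hcpos] at h
    exact (ENNReal.eq_inv_of_mul_eq_one_left h.symm).trans (inv_inv _)
  ext s hs
  rw [Measure.map_apply measurable_inv_mul_cols hs, hμ,
    withDensity_apply _ (measurable_inv_mul_cols hs), withDensity_apply _ hs,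
    ← lintegral_indicator (measurable_inv_mul_cols hs), ← lintegral_indicator hs]
  have h := lintegral_trace_inv_mul_cols (m := m) (n := n) hf
    (φ := s.indicator 1) (measurable_one.indicator hs)
  rw [hK, ← lintegral_const_mul' _ _ ENNReal.ofReal_ne_top] at h
  refine (lintegral_congr fun A => ?_).trans (h.trans (lintegral_congr fun Z => ?_))
  · by_cases hA : A ∈ (fun A : Fin m → Fin (m + n) → ℝ => of.symm
      (((of A).submatrix id (Fin.castAdd n))⁻¹ * (of A).submatrix id (Fin.natAdd m))) ⁻¹' s
    · rw [Set.indicator_of_mem hA, Set.indicator_of_mem (Set.mem_preimage.1 hA)]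
      simp
    · rw [Set.indicator_of_notMem hA, Set.indicator_of_notMem (mt Set.mem_preimage.2 hA), zero_mul]
  · by_cases hZ : Z ∈ s <;> simp [hZ, ENNReal.ofReal_mul hcpos.le]
end

section
/- Let m, n ≥ 1 be integers and let f₁, f₂ : ℝ → ℝ be measurable nonnegative functions such that for each k = 1, 2 the measure on real m×(m+n) matrices with density A ↦ f_k(tr(A Aᵀ)) with respect to Lebesgue measure is a probability measure. Then the integrals I_k = ∫ f_k(tr(B Bᵀ)) · |det B|ⁿ dB over all real m×m matrices B are finite and equal: I₁ = I₂ < ∞. Moreover their common value is π^(−mn/2) · ∏_{j=1}^{n} Γ((m+j)/2)/Γ(j/2). -/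
open MeasureTheory Matrix
open scoped ENNReal Real

theorem exists_lintegral_homogeneous_eq {E : Type*} [NormedAddCommGroup E] [NormedSpace ℝ E]
    [FiniteDimensional ℝ E] [Nontrivial E] [MeasurableSpace E] [BorelSpace E]
    (μ : Measure E) [μ.IsAddHaarMeasure] {q : E → ℝ} (hq : Measurable q)
    (hq_pos : ∀ x, x ≠ 0 → 0 < q x) (hq_smul : ∀ r : ℝ, 0 < r → ∀ x, q (r • x) = r * q x)
    {g : E → ℝ≥0∞} (hg : Measurable g) (d : ℕ)
    (hg_smul : ∀ r : ℝ, 0 < r → ∀ x, g (r • x) = ENNReal.ofReal (r ^ d) * g x) :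
    ∃ C : ℝ≥0∞, ∀ F : ℝ → ℝ≥0∞, Measurable F → ∫⁻ x, F (q x) * g x ∂μ =
      C * ∫⁻ r in Set.Ioi (0 : ℝ), F r * ENNReal.ofReal (r ^ (Module.finrank ℝ E - 1 + d)) := by
  set N := Module.finrank ℝ E - 1 with hN
  refine ⟨∫⁻ s : Metric.sphere (0 : E) 1,
    g s * ENNReal.ofReal ((q s)⁻¹ ^ (N + d + 1)) ∂μ.toSphere, fun F hF => ?_⟩
  have hscale : ∀ a : ℝ, 0 < a → ∫⁻ r in Set.Ioi (0 : ℝ), F (r * a) * ENNReal.ofReal (r ^ (N + d)) =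
      ENNReal.ofReal (a⁻¹ ^ (N + d + 1)) *
        ∫⁻ r in Set.Ioi (0 : ℝ), F r * ENNReal.ofReal (r ^ (N + d)) := by
    intro a ha
    have himg : (fun r : ℝ => a⁻¹ * r) '' Set.Ioi 0 = Set.Ioi 0 := by
      rw [Set.image_mul_left_Ioi (inv_pos.2 ha), mul_zero]
    conv_lhs => rw [← himg]
    rw [lintegral_image_eq_lintegral_abs_deriv_mul (f' := fun _ => a⁻¹) measurableSet_Ioi
      (fun x _ => by simpa using ((hasDerivAt_id x).const_mul a⁻¹).hasDerivWithinAt)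
      (mul_right_injective₀ (inv_ne_zero ha.ne')).injOn,
      ← lintegral_const_mul' _ _ ENNReal.ofReal_ne_top]
    refine setLIntegral_congr_fun measurableSet_Ioi fun r hr => ?_
    have hr : 0 < r := hr
    have h1 : a⁻¹ * r * a = r := by field_simp
    simp only [h1]
    rw [abs_of_pos (inv_pos.2 ha), mul_left_comm, mul_left_comm (ENNReal.ofReal _) (F r),
      ← ENNReal.ofReal_mul (by positivity), ← ENNReal.ofReal_mul (by positivity)]
    congr 2
    ring
  have hG : Measurable fun p : Metric.sphere (0 : E) 1 × Set.Ioi (0 : ℝ) =>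
      F (p.2 * q p.1) * (ENNReal.ofReal ((p.2 : ℝ) ^ d) * g p.1) := by fun_prop
  calc ∫⁻ x, F (q x) * g x ∂μ
      = ∫⁻ x : ({0}ᶜ : Set E), F (q x) * g x ∂(μ.comap (↑)) := by
        rw [lintegral_subtype_comap (measurableSet_singleton _).compl
          (fun x => F (q x) * g x), restrict_compl_singleton]
    _ = ∫⁻ x : ({0}ᶜ : Set E), (fun p : Metric.sphere (0 : E) 1 × Set.Ioi (0 : ℝ) =>
          F (p.2 * q p.1) * (ENNReal.ofReal ((p.2 : ℝ) ^ d) * g p.1))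
            (homeomorphUnitSphereProd E x) ∂(μ.comap (↑)) := by
        refine lintegral_congr fun x => ?_
        obtain ⟨p, rfl⟩ := (homeomorphUnitSphereProd E).symm.surjective x
        have hp : (0 : ℝ) < p.2 := p.2.2
        simp only [Homeomorph.apply_symm_apply, homeomorphUnitSphereProd_symm_apply_coe]
        rw [hq_smul _ hp, hg_smul _ hp]
    _ = ∫⁻ p, F (p.2 * q p.1) * (ENNReal.ofReal ((p.2 : ℝ) ^ d) * g p.1)
          ∂(μ.toSphere.prod (Measure.volumeIoiPow N)) :=
        μ.measurePreserving_homeomorphUnitSphereProd.lintegral_comp hG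
    _ = ∫⁻ s : Metric.sphere (0 : E) 1, ∫⁻ r : Set.Ioi (0 : ℝ),
          F (r * q s) * (ENNReal.ofReal ((r : ℝ) ^ d) * g s)
          ∂(Measure.volumeIoiPow N) ∂μ.toSphere := lintegral_prod _ hG.aemeasurable
    _ = ∫⁻ s : Metric.sphere (0 : E) 1, g s * ENNReal.ofReal ((q s)⁻¹ ^ (N + d + 1)) *
          (∫⁻ r in Set.Ioi (0 : ℝ), F r * ENNReal.ofReal (r ^ (N + d))) ∂μ.toSphere := by
        refine lintegral_congr fun s => ?_
        have hs : 0 < q s := hq_pos _ fun h => by simpa [h] using s.2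
        rw [Measure.volumeIoiPow, lintegral_withDensity_eq_lintegral_mul _ (by fun_prop)
          (by fun_prop), mul_assoc, ← hscale _ hs, ← lintegral_const_mul _ (by fun_prop)]
        simp only [Pi.mul_apply]
        rw [lintegral_subtype_comap measurableSet_Ioi (fun r : ℝ =>
          ENNReal.ofReal (r ^ N) * (F (r * q s) * (ENNReal.ofReal (r ^ d) * g s)))]
        refine setLIntegral_congr_fun measurableSet_Ioi fun r hr => ?_
        have hr : 0 < r := hr
        rw [pow_add, ENNReal.ofReal_mul (by positivity)]
        ring
    _ = _ := lintegral_mul_const _ (by fun_prop)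

theorem lintegral_ofReal_fintype_prod_eq_pow {E : Type*} [MeasureSpace E]
    [SigmaFinite (volume : Measure E)] {h : E → ℝ} (hh : Integrable h) (hh0 : ∀ x, 0 ≤ h x)
    (m : ℕ) : ∫⁻ c : Fin m → E, ENNReal.ofReal (∏ i, h (c i)) = ENNReal.ofReal ((∫ x, h x) ^ m) := by
  have hi : Integrable (fun c : Fin m → E => ∏ i, h (c i)) := Integrable.fintype_prod fun _ => hh
  rw [← ofReal_integral_eq_lintegral_ofReal hi
    (.of_forall fun c => Finset.prod_nonneg fun i _ => hh0 _),
    integral_fintype_prod_volume_eq_pow h, Fintype.card_fin]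

theorem lintegral_exp_neg_sum_sq (k : ℕ) :
    ∫⁻ c : Fin k → ℝ, ENNReal.ofReal (Real.exp (-∑ j, c j ^ 2)) =
      ENNReal.ofReal (π ^ ((k : ℝ) / 2)) := by
  have h : ∀ c : Fin k → ℝ, Real.exp (-∑ j, c j ^ 2) = ∏ j, Real.exp (-1 * c j ^ 2) := by
    intro c
    rw [← Finset.sum_neg_distrib, Real.exp_sum]
    simp
  simp_rw [h]
  rw [lintegral_ofReal_fintype_prod_eq_pow (integrable_exp_neg_mul_sq one_pos)
    (fun _ => Real.exp_nonneg _), integral_gaussian, Real.sqrt_eq_rpow, ← Real.rpow_natCast,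
    ← Real.rpow_mul (by positivity)]
  ring_nf

theorem lintegral_exp_neg_sum_sum_sq (m k : ℕ) :
    ∫⁻ c : Fin m → Fin k → ℝ, ENNReal.ofReal (Real.exp (-∑ i, ∑ j, c i j ^ 2)) =
      ENNReal.ofReal (π ^ ((m * k : ℝ) / 2)) := by
  have hm : Measurable fun c : Fin k → ℝ => Real.exp (-∑ j, c j ^ 2) := by fun_prop
  have hint : Integrable fun c : Fin k → ℝ => Real.exp (-∑ j, c j ^ 2) := by
    refine ⟨hm.aestronglyMeasurable, ?_⟩
    rw [hasFiniteIntegral_iff_ofReal (.of_forall fun _ => Real.exp_nonneg _),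
      lintegral_exp_neg_sum_sq]
    exact ENNReal.ofReal_lt_top
  have h : ∀ c : Fin m → Fin k → ℝ,
      Real.exp (-∑ i, ∑ j, c i j ^ 2) = ∏ i, Real.exp (-∑ j, c i j ^ 2) := by
    intro c
    rw [← Finset.sum_neg_distrib, Real.exp_sum]
  have hval : ∫ c : Fin k → ℝ, Real.exp (-∑ j, c j ^ 2) = π ^ ((k : ℝ) / 2) := by
    rw [integral_eq_lintegral_of_nonneg_ae (.of_forall fun _ => Real.exp_nonneg _)
      hm.aestronglyMeasurable, lintegral_exp_neg_sum_sq, ENNReal.toReal_ofReal (by positivity)]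
  simp_rw [h]
  rw [lintegral_ofReal_fintype_prod_eq_pow hint (fun _ => Real.exp_nonneg _), hval,
    ← Real.rpow_natCast, ← Real.rpow_mul (by positivity)]
  ring_nf

theorem lintegral_Ioi_exp (k : ℕ) :
    ∫⁻ r in Set.Ioi (0 : ℝ), ENNReal.ofReal (Real.exp (-r ^ 2)) * ENNReal.ofReal (r ^ k) =
      ENNReal.ofReal (1 / 2 * Real.Gamma ((k + 1) / 2)) := by
  have h := integral_rpow_mul_exp_neg_rpow (p := 2) (q := k) two_pos
    (by linarith [k.cast_nonneg (α := ℝ)])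
  have hpos : 0 < 1 / 2 * Real.Gamma (((k : ℝ) + 1) / 2) := by
    have := Real.Gamma_pos_of_pos (s := ((k : ℝ) + 1) / 2) (by positivity)
    positivity
  have hint : IntegrableOn (fun x : ℝ => x ^ (k : ℝ) * Real.exp (-x ^ (2 : ℝ))) (Set.Ioi 0) := by
    by_contra hn
    rw [integral_undef hn] at h
    exact hpos.ne h
  rw [← h, ofReal_integral_eq_lintegral_ofReal hint]
  · refine setLIntegral_congr_fun measurableSet_Ioi fun r hr => ?_
    simp only [← Real.rpow_natCast]
    rw [mul_comm, ENNReal.ofReal_mul (Real.rpow_nonneg (le_of_lt hr) _)]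
    norm_cast
  · refine (ae_restrict_mem measurableSet_Ioi).mono fun r hr => ?_
    have : 0 < r := hr
    simp only [Pi.zero_apply]
    positivity

theorem exists_orthogonal_vecMul_eq_single {k : ℕ} (b : Fin (k + 1) → ℝ) :
    ∃ Q : Matrix (Fin (k + 1)) (Fin (k + 1)) ℝ, Q * Qᵀ = 1 ∧
      b ᵥ* Q = Pi.single 0 (√(∑ j, b j ^ 2)) := by
  rcases eq_or_ne b 0 with rfl | hb
  · exact ⟨1, by simp⟩
  set v : EuclideanSpace ℝ (Fin (k + 1)) := WithLp.toLp 2 b with hv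
  have hv0 : v ≠ 0 := fun h => hb (by simpa [hv] using h)
  have hnorm : ‖v‖ = √(∑ j, b j ^ 2) := by simp [EuclideanSpace.norm_eq, hv]
  have hortho : Orthonormal ℝ
      (Set.domRestrict {0} fun _ : Fin (k + 1) => (‖v‖⁻¹ : ℝ) • v) := by
    constructor
    · intro i
      simp [norm_smul, hv0]
    · rintro ⟨i, rfl⟩ ⟨j, rfl⟩ hij
      exact absurd rfl hij
  obtain ⟨e, he⟩ := hortho.exists_orthonormalBasis_extension_of_card_eq (by simp)
  have he0 : v = ‖v‖ • e 0 := by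
    rw [he 0 rfl, smul_smul, mul_inv_cancel₀ (norm_ne_zero_iff.2 hv0), one_smul]
  refine ⟨Matrix.of fun i j => e j i, mul_eq_one_comm.1 ?_, ?_⟩
  · ext i j
    have := orthonormal_iff_ite.1 e.orthonormal i j
    simp only [PiLp.inner_apply, RCLike.inner_apply, conj_trivial] at this
    simp [Matrix.mul_apply, Matrix.one_apply, ← this, mul_comm]
  · ext j
    have := orthonormal_iff_ite.1 e.orthonormal 0 j
    simp only [PiLp.inner_apply, RCLike.inner_apply, conj_trivial] at this
    have hbi : ∀ i, b i = ‖v‖ * e 0 i := fun i => congrArg (fun w => w.ofLp i) he0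
    rw [← hnorm]
    simp only [Matrix.vecMul, dotProduct, Matrix.of_apply]
    rw [Finset.sum_congr rfl fun i _ => show b i * e j i = ‖v‖ * (e j i * e 0 i) by rw [hbi]; ring,
      ← Finset.mul_sum, this, Pi.single_apply]
    simp [eq_comm]

theorem sum_sq_vecMul {k : ℕ} {Q : Matrix (Fin k) (Fin k) ℝ} (hQ : Q * Qᵀ = 1) (v : Fin k → ℝ) :
    ∑ j, (v ᵥ* Q) j ^ 2 = ∑ j, v j ^ 2 := by
  have h : (v ᵥ* Q) ⬝ᵥ (v ᵥ* Q) = v ⬝ᵥ v := by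
    conv_lhs => rw [← mulVec_transpose Q v]
    rw [mulVec_transpose, ← dotProduct_mulVec, ← mulVec_transpose, mulVec_mulVec, hQ, one_mulVec]
  simpa [dotProduct, sq] using h

theorem abs_det_eq_one_of_mul_transpose {k : ℕ} {Q : Matrix (Fin k) (Fin k) ℝ}
    (hQ : Q * Qᵀ = 1) : |Q.det| = 1 := by
  have h := congrArg Matrix.det hQ
  rw [det_mul, det_transpose, det_one, ← sq] at h
  exact (pow_eq_one_iff_of_nonneg (abs_nonneg _) two_ne_zero).1 (by rwa [sq_abs])

theorem measurePreserving_vecMul {k : ℕ} {Q : Matrix (Fin k) (Fin k) ℝ} (hQ : Q * Qᵀ = 1) :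
    MeasurePreserving fun v : Fin k → ℝ => v ᵥ* Q := by
  have h1 := abs_det_eq_one_of_mul_transpose hQ
  have h := Real.map_matrix_volume_pi_eq_smul_volume_pi (M := Qᵀ) fun h0 => by
    rw [det_transpose] at h0; simp [h0] at h1
  have hfun : (fun v : Fin k → ℝ => v ᵥ* Q) = toLin' Qᵀ := by
    ext v; simp [mulVec_transpose]
  rw [det_transpose, abs_inv, h1] at h
  rw [hfun]
  exact ⟨(LinearMap.continuous_of_finiteDimensional _).measurable, by simpa using h⟩

theorem abs_det_cons_of_vecMul_eq_single {k : ℕ} {Q : Matrix (Fin (k + 1)) (Fin (k + 1)) ℝ}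
    (hQ : Q * Qᵀ = 1) {b : Fin (k + 1) → ℝ} {a : ℝ} (ha : 0 ≤ a) (hb : b ᵥ* Q = Pi.single 0 a)
    (C : Fin k → Fin (k + 1) → ℝ) :
    |(Matrix.of (Fin.cons b C : Fin (k + 1) → Fin (k + 1) → ℝ)).det| =
      a * |(Matrix.of fun i j : Fin k => (C i ᵥ* Q) j.succ).det| := by
  set B : Matrix (Fin (k + 1)) (Fin (k + 1)) ℝ := Matrix.of (Fin.cons b C) with hB
  have h1 : |B.det| = |(B * Q).det| := by
    rw [det_mul, abs_mul, abs_det_eq_one_of_mul_transpose hQ, mul_one]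
  have hrow0 : ∀ j, (B * Q) 0 j = (b ᵥ* Q) j := fun j => rfl
  rw [h1, det_succ_row_zero, Fin.sum_univ_succ, Finset.sum_eq_zero]
  · rw [hrow0, hb]
    simp only [Fin.val_zero, pow_zero, Pi.single_eq_same, one_mul, add_zero, abs_mul,
      abs_of_nonneg ha]
    rfl
  · intro j _
    rw [hrow0, hb]
    simp

theorem measurePreserving_splitColumn (m k : ℕ) :
    MeasurePreserving fun D : Fin m → Fin (k + 1) → ℝ =>
      ((fun i => D i 0, fun i j => D i j.succ) : (Fin m → ℝ) × (Fin m → Fin k → ℝ)) :=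
  (volume_measurePreserving_arrowProdEquivProdArrow ℝ (Fin k → ℝ) (Fin m)).comp
    (volume_preserving_pi fun _ : Fin m =>
      volume_preserving_piFinSuccAbove (fun _ : Fin (k + 1) => ℝ) 0)

theorem lintegral_exp_det_succ (m n : ℕ) :
    ∫⁻ B : Fin (m + 1) → Fin (m + 1) → ℝ,
        ENNReal.ofReal (Real.exp (-∑ i, ∑ j, B i j ^ 2)) * ENNReal.ofReal (|(Matrix.of B).det| ^ n) =
      (∫⁻ b : Fin (m + 1) → ℝ,
        ENNReal.ofReal (Real.exp (-∑ j, b j ^ 2)) * ENNReal.ofReal (√(∑ j, b j ^ 2) ^ n)) *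
      ((∫⁻ c : Fin m → ℝ, ENNReal.ofReal (Real.exp (-∑ j, c j ^ 2))) *
       ∫⁻ B : Fin m → Fin m → ℝ,
        ENNReal.ofReal (Real.exp (-∑ i, ∑ j, B i j ^ 2)) *
          ENNReal.ofReal (|(Matrix.of B).det| ^ n)) := by
  have hdet : ∀ l : ℕ, Measurable fun B : Fin l → Fin l → ℝ => (Matrix.of B).det := fun l =>
    (show Continuous fun B : Fin l → Fin l → ℝ => (Matrix.of B).det from
      Continuous.matrix_det continuous_id).measurable
  have hdet' := hdet m
  have hdet'' := hdet (m + 1)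
  set Φ : (Fin (m + 1) → Fin (m + 1) → ℝ) → ℝ≥0∞ := fun B =>
    ENNReal.ofReal (Real.exp (-∑ i, ∑ j, B i j ^ 2)) * ENNReal.ofReal (|(Matrix.of B).det| ^ n)
    with hΦ
  have hΦm : Measurable Φ := by fun_prop
  set Θ : (Fin m → ℝ) × (Fin m → Fin m → ℝ) → ℝ≥0∞ := fun p =>
    ENNReal.ofReal (Real.exp (-∑ j, p.1 j ^ 2)) *
      (ENNReal.ofReal (Real.exp (-∑ i, ∑ j, p.2 i j ^ 2)) *
          ENNReal.ofReal (|(Matrix.of p.2).det| ^ n)) with hΘ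
  have hΘm : Measurable Θ := by
    have : Measurable fun p : (Fin m → ℝ) × (Fin m → Fin m → ℝ) => (Matrix.of p.2).det :=
      hdet'.comp measurable_snd
    fun_prop
  have hΘint : ∫⁻ p, Θ p = (∫⁻ c : Fin m → ℝ, ENNReal.ofReal (Real.exp (-∑ j, c j ^ 2))) *
       ∫⁻ B : Fin m → Fin m → ℝ, ENNReal.ofReal (Real.exp (-∑ i, ∑ j, B i j ^ 2)) *
          ENNReal.ofReal (|(Matrix.of B).det| ^ n) :=
    lintegral_prod_mul
      (f := fun c : Fin m → ℝ => ENNReal.ofReal (Real.exp (-∑ j, c j ^ 2)))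
      (g := fun B : Fin m → Fin m → ℝ => ENNReal.ofReal (Real.exp (-∑ i, ∑ j, B i j ^ 2)) *
        ENNReal.ofReal (|(Matrix.of B).det| ^ n))
      (Measurable.aemeasurable (by fun_prop)) (Measurable.aemeasurable (by fun_prop))
  have hpres := (volume_preserving_piFinSuccAbove
    (fun _ : Fin (m + 1) => Fin (m + 1) → ℝ) 0).symm
  rw [← hΘint, ← hpres.lintegral_comp hΦm, Measure.volume_eq_prod,
    lintegral_prod (fun p => Φ ((MeasurableEquiv.piFinSuccAbove
      (fun _ : Fin (m + 1) => Fin (m + 1) → ℝ) 0).symm p))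
      (hΦm.comp hpres.measurable).aemeasurable,
    ← lintegral_mul_const _ (by fun_prop)]
  refine lintegral_congr fun b => ?_
  obtain ⟨Q, hQ, hQb⟩ := exists_orthogonal_vecMul_eq_single b
  have hrot := (measurePreserving_splitColumn m m).comp
    (volume_preserving_pi fun _ : Fin m => measurePreserving_vecMul hQ)
  rw [← hrot.lintegral_comp hΘm, ← lintegral_const_mul' _ _
    (ENNReal.mul_ne_top ENNReal.ofReal_ne_top ENNReal.ofReal_ne_top)]
  refine lintegral_congr fun C => ?_
  have hcons : (MeasurableEquiv.piFinSuccAbove (fun _ : Fin (m + 1) => Fin (m + 1) → ℝ) 0).symm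
      (b, C) = (Fin.cons b C : Fin (m + 1) → Fin (m + 1) → ℝ) := by
    simp [MeasurableEquiv.piFinSuccAbove, Fin.insertNthEquiv, Fin.insertNth_zero']
  rw [hcons]
  have hsum : ∑ i, ∑ j, (Fin.cons b C : Fin (m + 1) → Fin (m + 1) → ℝ) i j ^ 2 =
      ∑ j, b j ^ 2 + (∑ i, (C i ᵥ* Q) 0 ^ 2 + ∑ i, ∑ j : Fin m, (C i ᵥ* Q) j.succ ^ 2) := by
    rw [Fin.sum_univ_succ, ← Finset.sum_add_distrib]
    refine congrArg (_ + ·) (Finset.sum_congr rfl fun i _ => ?_)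
    rw [← Fin.sum_univ_succ fun j => (C i ᵥ* Q) j ^ 2, sum_sq_vecMul hQ]
    rfl
  simp only [hΦ, hΘ, Function.comp_apply, hsum]
  rw [abs_det_cons_of_vecMul_eq_single hQ (Real.sqrt_nonneg _) hQb, neg_add, neg_add,
    Real.exp_add, Real.exp_add, mul_pow, ENNReal.ofReal_mul (by positivity),
    ENNReal.ofReal_mul (by positivity), ENNReal.ofReal_mul (by positivity)]
  ring

theorem lintegral_exp_mul_sqrt_pow (m n : ℕ) :
    ∫⁻ b : Fin (m + 1) → ℝ,
        ENNReal.ofReal (Real.exp (-∑ j, b j ^ 2)) * ENNReal.ofReal (√(∑ j, b j ^ 2) ^ n) =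
      ENNReal.ofReal (π ^ (((m + 1 : ℕ) : ℝ) / 2) *
        (Real.Gamma ((n + (m + 1)) / 2) / Real.Gamma ((m + 1) / 2))) := by
  have hG : 0 < Real.Gamma (((m : ℝ) + 1) / 2) := Real.Gamma_pos_of_pos (by positivity)
  have hsum : ∀ b : Fin (m + 1) → ℝ, 0 ≤ ∑ j, b j ^ 2 := fun b => by positivity
  obtain ⟨C, hC⟩ := exists_lintegral_homogeneous_eq (volume : Measure (Fin (m + 1) → ℝ))
    (q := fun b => √(∑ j, b j ^ 2)) (by fun_prop)
    (fun b hb => by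
      obtain ⟨j, hj⟩ := Function.ne_iff.1 hb
      have hj : b j ≠ 0 := hj
      exact Real.sqrt_pos.2 (Finset.sum_pos' (fun _ _ => sq_nonneg _)
        ⟨j, Finset.mem_univ _, by positivity⟩))
    (fun r hr b => by
      simp only [Pi.smul_apply, smul_eq_mul, mul_pow, ← Finset.mul_sum]
      rw [Real.sqrt_mul (by positivity), Real.sqrt_sq hr.le])
    (g := fun _ => 1) measurable_const 0 (by simp)
  have h0 := hC (fun r => ENNReal.ofReal (Real.exp (-r ^ 2))) (by fun_prop)
  have hn := hC (fun r => ENNReal.ofReal (Real.exp (-r ^ 2)) * ENNReal.ofReal (r ^ n))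
    (by fun_prop)
  simp only [Real.sq_sqrt (hsum _), mul_one, Module.finrank_fin_fun, Nat.add_sub_cancel,
    add_zero, lintegral_exp_neg_sum_sq, lintegral_Ioi_exp] at h0 hn
  have hC' : C = ENNReal.ofReal (π ^ (((m + 1 : ℕ) : ℝ) / 2) /
      (1 / 2 * Real.Gamma (((m : ℝ) + 1) / 2))) := by
    rw [ENNReal.ofReal_div_of_pos (by positivity), h0]
    exact (ENNReal.mul_div_cancel_right (by simpa using hG) ENNReal.ofReal_ne_top).symm
  have hint : ∫⁻ r in Set.Ioi (0 : ℝ), ENNReal.ofReal (Real.exp (-r ^ 2)) *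
      ENNReal.ofReal (r ^ n) * ENNReal.ofReal (r ^ m) =
      ENNReal.ofReal (1 / 2 * Real.Gamma (((n + m : ℕ) + 1) / 2)) := by
    rw [← lintegral_Ioi_exp]
    refine setLIntegral_congr_fun measurableSet_Ioi fun r hr => ?_
    have hr : 0 < r := hr
    rw [pow_add, ENNReal.ofReal_mul (by positivity), mul_assoc]
  rw [hn, hint, hC', ← ENNReal.ofReal_mul (by positivity)]
  congr 1
  push_cast
  rw [← add_assoc]
  field_simp

theorem lintegral_exp_det (m n : ℕ) :
    ∫⁻ B : Fin m → Fin m → ℝ,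
        ENNReal.ofReal (Real.exp (-∑ i, ∑ j, B i j ^ 2)) *
          ENNReal.ofReal (|(Matrix.of B).det| ^ n) =
      ENNReal.ofReal (π ^ ((m * m : ℝ) / 2) * ∏ i ∈ Finset.range m,
        Real.Gamma ((n + (i + 1) : ℝ) / 2) / Real.Gamma (((i + 1) : ℝ) / 2)) := by
  have hpos : ∀ k l : ℕ, 0 ≤ Real.Gamma ((k + (l + 1) : ℝ) / 2) / Real.Gamma (((l + 1) : ℝ) / 2) :=
    fun k l => div_nonneg (Real.Gamma_nonneg_of_nonneg (by positivity))
      (Real.Gamma_nonneg_of_nonneg (by positivity))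
  induction m with
  | zero => simp [volume_pi]
  | succ m ih =>
    rw [lintegral_exp_det_succ, ih, lintegral_exp_neg_sum_sq, lintegral_exp_mul_sqrt_pow,
      ← ENNReal.ofReal_mul (by positivity),
      ← ENNReal.ofReal_mul (mul_nonneg (by positivity) (hpos _ _)), Finset.prod_range_succ]
    congr 1
    have hpi : π ^ (((m + 1 : ℕ) * (m + 1 : ℕ) : ℝ) / 2) =
        π ^ (((m + 1 : ℕ) : ℝ) / 2) * (π ^ ((m : ℝ) / 2) * π ^ ((m * m : ℝ) / 2)) := by
      rw [← Real.rpow_add Real.pi_pos, ← Real.rpow_add Real.pi_pos]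
      congr 1
      push_cast
      ring
    rw [hpi]
    ring

theorem prod_Gamma_div_comm (m n : ℕ) :
    ∏ i ∈ Finset.range m, Real.Gamma ((n + (i + 1) : ℝ) / 2) / Real.Gamma (((i + 1) : ℝ) / 2) =
      ∏ j ∈ Finset.range n,
        Real.Gamma ((m + (j + 1) : ℝ) / 2) / Real.Gamma (((j + 1) : ℝ) / 2) := by
  have hpos : ∀ k : ℕ, ∏ i ∈ Finset.range k, Real.Gamma (((i + 1) : ℝ) / 2) ≠ 0 := fun k =>
    Finset.prod_ne_zero_iff.2 fun i _ => (Real.Gamma_pos_of_pos (by positivity)).ne'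
  have h : ∀ k l : ℕ, ∏ i ∈ Finset.range (k + l), Real.Gamma (((i + 1) : ℝ) / 2) =
      (∏ i ∈ Finset.range k, Real.Gamma (((i + 1) : ℝ) / 2)) *
        ∏ i ∈ Finset.range l, Real.Gamma ((k + (i + 1) : ℝ) / 2) := by
    intro k l
    rw [Finset.prod_range_add]
    push_cast
    simp only [add_assoc]
  rw [Finset.prod_div_distrib, Finset.prod_div_distrib, div_eq_div_iff (hpos _) (hpos _),
    mul_comm, ← h, mul_comm, ← h, add_comm]

theorem trace_of_mul_transpose {m k : ℕ} (A : Fin m → Fin k → ℝ) :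
    Matrix.trace (Matrix.of A * (Matrix.of A)ᵀ) = ∑ i, ∑ j, A i j ^ 2 := by
  simp [Matrix.trace, Matrix.mul_apply, sq]

theorem exists_lintegral_matrix_homogeneous_eq {m k : ℕ} (hm : 1 ≤ m) (hk : 1 ≤ k)
    {g : (Fin m → Fin k → ℝ) → ℝ≥0∞} (hg : Measurable g) (d : ℕ)
    (hg_smul : ∀ r : ℝ, 0 < r → ∀ x, g (r • x) = ENNReal.ofReal (r ^ d) * g x) :
    ∃ C : ℝ≥0∞, ∀ F : ℝ → ℝ≥0∞, Measurable F → ∫⁻ A, F (∑ i, ∑ j, A i j ^ 2) * g A =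
      C * ∫⁻ r in Set.Ioi (0 : ℝ), F (r ^ 2) * ENNReal.ofReal (r ^ (m * k - 1 + d)) := by
  have : NeZero m := ⟨by omega⟩
  have : NeZero k := ⟨by omega⟩
  have hsum : ∀ A : Fin m → Fin k → ℝ, 0 ≤ ∑ i, ∑ j, A i j ^ 2 := fun A => by positivity
  obtain ⟨C, hC⟩ := exists_lintegral_homogeneous_eq (volume : Measure (Fin m → Fin k → ℝ))
    (q := fun A => √(∑ i, ∑ j, A i j ^ 2)) (by fun_prop)
    (fun A hA => by
      obtain ⟨i, hi⟩ := Function.ne_iff.1 hA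
      obtain ⟨j, hj⟩ := Function.ne_iff.1 hi
      have hj : A i j ≠ 0 := hj
      exact Real.sqrt_pos.2 (Finset.sum_pos'
        (fun _ _ => Finset.sum_nonneg fun _ _ => sq_nonneg _)
        ⟨i, Finset.mem_univ _, Finset.sum_pos' (fun _ _ => sq_nonneg _)
          ⟨j, Finset.mem_univ _, by positivity⟩⟩))
    (fun r hr A => by
      simp only [Pi.smul_apply, smul_eq_mul, mul_pow, ← Finset.mul_sum]
      rw [Real.sqrt_mul (by positivity), Real.sqrt_sq hr.le])
    hg d hg_smul
  refine ⟨C, fun F hF => ?_⟩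
  have h := hC (fun r => F (r ^ 2)) (by fun_prop)
  simp only [Real.sq_sqrt (hsum _)] at h
  rw [h]
  simp [Module.finrank_pi_fintype]

theorem lintegral_mul_abs_det_pow_eq (m n : ℕ) (hm : 1 ≤ m) (f : ℝ → ℝ) (hf : Measurable f)
    (hf0 : ∀ x, 0 ≤ f x)
    (hprob : IsProbabilityMeasure (volume.withDensity fun A : Fin m → Fin (m + n) → ℝ =>
      ENNReal.ofReal (f (Matrix.trace (Matrix.of A * (Matrix.of A)ᵀ))))) :
    (∫⁻ B : Fin m → Fin m → ℝ,
        ENNReal.ofReal (f (Matrix.trace (Matrix.of B * (Matrix.of B)ᵀ)) *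
          |Matrix.det (Matrix.of B)| ^ n))
      = ENNReal.ofReal (Real.pi ^ (-(m * n : ℝ) / 2) *
          ∏ j ∈ Finset.range n,
            Real.Gamma ((m + (j + 1) : ℝ) / 2) / Real.Gamma (((j + 1) : ℝ) / 2)) := by
  have hone := hprob.measure_univ
  rw [withDensity_apply _ MeasurableSet.univ, Measure.restrict_univ] at hone
  simp only [trace_of_mul_transpose] at hone ⊢
  simp_rw [ENNReal.ofReal_mul (hf0 _)]
  obtain ⟨C₁, hC₁⟩ := exists_lintegral_matrix_homogeneous_eq (k := m + n) hm (by omega)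
    (g := fun _ => 1) measurable_const 0 (by simp)
  have hdet : Measurable fun B : Fin m → Fin m → ℝ => (Matrix.of B).det :=
    (show Continuous fun B : Fin m → Fin m → ℝ => (Matrix.of B).det from
      Continuous.matrix_det continuous_id).measurable
  obtain ⟨C₂, hC₂⟩ := exists_lintegral_matrix_homogeneous_eq (k := m) hm hm
    (g := fun B => ENNReal.ofReal (|(Matrix.of B).det| ^ n)) (by fun_prop) (m * n)
    (fun r hr B => by
      rw [← ENNReal.ofReal_mul (by positivity)]
      have : Matrix.of (r • B) = r • Matrix.of B := rfl
      rw [this, det_smul, Fintype.card_fin, abs_mul, abs_of_pos (pow_pos hr _), mul_pow, pow_mul])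
  have hexp : m * m - 1 + m * n = m * (m + n) - 1 := by
    have : 1 ≤ m * m := Nat.mul_pos hm hm
    rw [mul_add]
    omega
  have hf1 := hC₁ (fun x => ENNReal.ofReal (f x)) (by fun_prop)
  have he1 := hC₁ (fun x => ENNReal.ofReal (Real.exp (-x))) (by fun_prop)
  have hf2 := hC₂ (fun x => ENNReal.ofReal (f x)) (by fun_prop)
  have he2 := hC₂ (fun x => ENNReal.ofReal (Real.exp (-x))) (by fun_prop)
  simp only [mul_one, add_zero] at hf1 he1
  rw [hone] at hf1
  rw [lintegral_exp_neg_sum_sum_sq] at he1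
  rw [lintegral_exp_det, hexp] at he2
  rw [hexp] at hf2
  have hkey : (∫⁻ B : Fin m → Fin m → ℝ, ENNReal.ofReal (f (∑ i, ∑ j, B i j ^ 2)) *
      ENNReal.ofReal (|(Matrix.of B).det| ^ n)) *
        ENNReal.ofReal (π ^ ((m * (m + n : ℕ) : ℝ) / 2)) =
      ENNReal.ofReal (π ^ ((m * m : ℝ) / 2) * ∏ i ∈ Finset.range m,
        Real.Gamma ((n + (i + 1) : ℝ) / 2) / Real.Gamma (((i + 1) : ℝ) / 2)) := by
    rw [hf2, he1, he2, mul_mul_mul_comm, mul_comm C₂ C₁, mul_mul_mul_comm, ← hf1, one_mul]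
  have hpi : 0 < π ^ ((m * (m + n : ℕ) : ℝ) / 2) := Real.rpow_pos_of_pos Real.pi_pos _
  rw [(ENNReal.eq_div_iff (by simpa using hpi) ENNReal.ofReal_ne_top).2
    ((mul_comm _ _).trans hkey), ← ENNReal.ofReal_div_of_pos hpi, prod_Gamma_div_comm,
    mul_div_right_comm, ← Real.rpow_sub Real.pi_pos]
  congr 3
  push_cast
  ring

/-- If `f₁, f₂` both normalize `A ↦ f(tr A Aᵀ)` to a probability density on real
`m × (m+n)` matrices, then `∫ f_k(tr B Bᵀ) |det B|ⁿ dB` is finite, independent of `k`,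
and equals `π^(-mn/2) ∏_{j=1}^n Γ((m+j)/2)/Γ(j/2)`. -/
theorem lemma_C_universal (m n : ℕ) (hm : 1 ≤ m) (hn : 1 ≤ n)
    (f₁ f₂ : ℝ → ℝ) (hf₁_meas : Measurable f₁) (hf₂_meas : Measurable f₂)
    (hf₁_nonneg : ∀ x, 0 ≤ f₁ x) (hf₂_nonneg : ∀ x, 0 ≤ f₂ x)
    (hprob₁ : IsProbabilityMeasure (volume.withDensity fun A : Fin m → Fin (m + n) → ℝ =>
      ENNReal.ofReal (f₁ (Matrix.trace (Matrix.of A * (Matrix.of A)ᵀ)))))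
    (hprob₂ : IsProbabilityMeasure (volume.withDensity fun A : Fin m → Fin (m + n) → ℝ =>
      ENNReal.ofReal (f₂ (Matrix.trace (Matrix.of A * (Matrix.of A)ᵀ))))) :
    (∫⁻ B : Fin m → Fin m → ℝ,
        ENNReal.ofReal (f₁ (Matrix.trace (Matrix.of B * (Matrix.of B)ᵀ)) *
          |Matrix.det (Matrix.of B)| ^ n))
      = ENNReal.ofReal (Real.pi ^ (-(m * n : ℝ) / 2) *
          ∏ j ∈ Finset.range n,
            Real.Gamma ((m + (j + 1) : ℝ) / 2) / Real.Gamma (((j + 1) : ℝ) / 2)) ∧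
    (∫⁻ B : Fin m → Fin m → ℝ,
        ENNReal.ofReal (f₂ (Matrix.trace (Matrix.of B * (Matrix.of B)ᵀ)) *
          |Matrix.det (Matrix.of B)| ^ n))
      = ENNReal.ofReal (Real.pi ^ (-(m * n : ℝ) / 2) *
          ∏ j ∈ Finset.range n,
            Real.Gamma ((m + (j + 1) : ℝ) / 2) / Real.Gamma (((j + 1) : ℝ) / 2)) := by
  exact ⟨lintegral_mul_abs_det_pow_eq m n hm f₁ hf₁_meas hf₁_nonneg hprob₁,
    lintegral_mul_abs_det_pow_eq m n hm f₂ hf₂_meas hf₂_nonneg hprob₂⟩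
end

section
/- For integers m ≥ 1 and n ≥ 1, the integral over all real m×m matrices B of e^(−tr(B Bᵀ)) · |det B|ⁿ with respect to Lebesgue measure equals π^(m²/2) · ∏_{j=1}^{n} Γ((m+j)/2)/Γ(j/2), which also equals π^(m²/2) · ∏_{j=1}^{m} Γ((n+j)/2)/Γ(j/2). -/
open MeasureTheory Matrix
open scoped ENNReal Real

/-- The moments of the Euclidean norm with respect to the Gaussian weight on `ℝ^(k+1)`. -/
theorem lintegral_exp_neg_dotProduct_self_mul_sqrt_pow (k n : ℕ) :
    ∫⁻ v : Fin (k + 1) → ℝ, ENNReal.ofReal (Real.exp (-(v ⬝ᵥ v)) * √(v ⬝ᵥ v) ^ n) =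
      ENNReal.ofReal (Real.pi ^ ((k + 1 : ℝ) / 2) *
        (Real.Gamma ((n + (k + 1) : ℝ) / 2) / Real.Gamma ((k + 1 : ℝ) / 2))) := by
  let f : ℝ → ℝ := fun r => Real.exp (-r ^ 2) * r ^ n
  have hf : ∀ x : EuclideanSpace ℝ (Fin (k + 1)),
      Real.exp (-(x.ofLp ⬝ᵥ x.ofLp)) * √(x.ofLp ⬝ᵥ x.ofLp) ^ n = f ‖x‖ := fun x => by
    have hx : x.ofLp ⬝ᵥ x.ofLp = ‖x‖ ^ 2 := by
      rw [EuclideanSpace.real_norm_sq_eq]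
      simp only [dotProduct, sq]
    simp only [f, hx, Real.sqrt_sq (norm_nonneg x)]
  have hradial : ∀ r ∈ Set.Ioi (0 : ℝ),
      r ^ k • f r = r ^ ((n + k : ℕ) : ℝ) * Real.exp (-r ^ (2 : ℝ)) := fun r _ => by
    simp only [f, smul_eq_mul, Real.rpow_natCast, Real.rpow_two]
    ring
  have hint : Integrable fun x : EuclideanSpace ℝ (Fin (k + 1)) => f ‖x‖ := by
    rw [integrable_fun_norm_addHaar volume (f := f), finrank_euclideanSpace_fin,
      Nat.add_sub_cancel, integrableOn_congr_fun hradial measurableSet_Ioi]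
    have h := integrableOn_rpow_mul_exp_neg_mul_sq (b := 1) one_pos
      (s := ((n + k : ℕ) : ℝ)) (by have := (n + k).cast_nonneg (α := ℝ); linarith)
    simpa using h
  calc
    _ = ∫⁻ x : EuclideanSpace ℝ (Fin (k + 1)), ENNReal.ofReal (f ‖x‖) := by
      rw [← (PiLp.volume_preserving_ofLp (Fin (k + 1))).lintegral_comp (by fun_prop)]
      simp only [hf]
    _ = ENNReal.ofReal (∫ x : EuclideanSpace ℝ (Fin (k + 1)), f ‖x‖) :=
      (ofReal_integral_eq_lintegral_ofReal hint
        (Filter.Eventually.of_forall fun x => by simp only [f, Pi.zero_apply]; positivity)).symm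
    _ = _ := by
      rw [integral_fun_norm_addHaar volume f, finrank_euclideanSpace_fin, Nat.add_sub_cancel,
        setIntegral_congr_fun measurableSet_Ioi hradial,
        integral_rpow_mul_exp_neg_rpow two_pos
          (by have := (n + k).cast_nonneg (α := ℝ); linarith),
        Measure.real, EuclideanSpace.volume_ball]
      have hk : ((k + 1 : ℕ) : ℝ) / 2 ≠ 0 := by positivity
      have hG : Real.Gamma ((k + 1 : ℝ) / 2) ≠ 0 := (Real.Gamma_pos_of_pos (by positivity)).ne'
      rw [Fintype.card_fin, Real.Gamma_add_one hk, ENNReal.ofReal_one, one_pow, one_mul,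
        ENNReal.toReal_ofReal (by
          have := Real.Gamma_pos_of_pos (s := ((k + 1 : ℕ) : ℝ) / 2) (by positivity)
          positivity),
        Real.sqrt_eq_rpow, ← Real.rpow_natCast, ← Real.rpow_mul Real.pi_pos.le]
      congr 1
      rw [one_div_mul_eq_div, nsmul_eq_mul, smul_eq_mul]
      push_cast
      rw [add_assoc (n : ℝ)]
      have hk' : (k + 1 : ℝ) ≠ 0 := by positivity
      field_simp

theorem lintegral_exp_neg_dotProduct_self (k : ℕ) :
    ∫⁻ v : Fin k → ℝ, ENNReal.ofReal (Real.exp (-(v ⬝ᵥ v))) =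
      ENNReal.ofReal (Real.pi ^ ((k : ℝ) / 2)) := by
  cases k with
  | zero => simp [volume_pi]
  | succ k =>
    have h := lintegral_exp_neg_dotProduct_self_mul_sqrt_pow k 0
    have hG : Real.Gamma ((k + 1 : ℝ) / 2) ≠ 0 := (Real.Gamma_pos_of_pos (by positivity)).ne'
    simpa [div_self hG] using h

/-- Any vector can be moved to the first coordinate axis by an isometry fixing the origin. -/
theorem exists_measurePreserving_dotProduct_map_eq_single (k : ℕ) (v : Fin (k + 1) → ℝ) :
    ∃ T : (Fin (k + 1) → ℝ) → (Fin (k + 1) → ℝ), MeasurePreserving T ∧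
      (∀ x y, T x ⬝ᵥ T y = x ⬝ᵥ y) ∧ T v = Pi.single 0 √(v ⬝ᵥ v) := by
  have hnorm : ‖WithLp.toLp 2 v‖ = ‖EuclideanSpace.single (0 : Fin (k + 1)) √(v ⬝ᵥ v)‖ := by
    rw [PiLp.norm_single, EuclideanSpace.norm_eq, Real.norm_of_nonneg (by positivity)]
    simp [dotProduct, sq]
  have hmap := Submodule.reflection_sub hnorm
  set L := (ℝ ∙ (WithLp.toLp 2 v - EuclideanSpace.single (0 : Fin (k + 1)) √(v ⬝ᵥ v)))ᗮ.reflection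
  refine ⟨fun x => (L (WithLp.toLp 2 x)).ofLp,
    (PiLp.volume_preserving_ofLp _).comp
      (L.measurePreserving.comp (PiLp.volume_preserving_toLp _)), fun x y => ?_, ?_⟩
  · exact L.inner_map_map (WithLp.toLp 2 y) (WithLp.toLp 2 x)
  · simp only [hmap]
    rfl

theorem abs_det_map_of_dotProduct_map_eq {ι : Type*} [Fintype ι] [DecidableEq ι]
    (T : (ι → ℝ) → (ι → ℝ)) (hT : ∀ x y, T x ⬝ᵥ T y = x ⬝ᵥ y) (B : ι → ι → ℝ) :
    |det (of fun i => T (B i))| = |det (of B)| := by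
  have h : (of fun i => T (B i)) * (of fun i => T (B i))ᵀ = of B * (of B)ᵀ := by
    ext i j
    exact hT (B i) (B j)
  have hdet := congrArg det h
  rw [det_mul, det_mul, det_transpose, det_transpose] at hdet
  rw [← sq_eq_sq_iff_abs_eq_abs, sq, sq, hdet]

theorem det_of_cons_single (k : ℕ) (a : ℝ) (W : Fin k → Fin (k + 1) → ℝ) :
    det (of (Fin.cons (Pi.single 0 a) W : Fin (k + 1) → Fin (k + 1) → ℝ)) =
      a * det (of fun i j => W i (Fin.succ j)) := by
  rw [det_succ_row_zero, Finset.sum_eq_single 0]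
  · simp only [of_apply, Fin.cons_zero, Pi.single_eq_same, Fin.val_zero, pow_zero, one_mul]
    congr 2
  · intro j _ hj
    simp [hj]
  · simp

theorem lintegral_exp_mul_abs_det_cons (k n : ℕ) (v : Fin (k + 1) → ℝ) :
    ∫⁻ W : Fin k → Fin (k + 1) → ℝ,
        ENNReal.ofReal (Real.exp (-∑ i, W i ⬝ᵥ W i) *
          |det (of (Fin.cons v W : Fin (k + 1) → Fin (k + 1) → ℝ))| ^ n) =
      ENNReal.ofReal (√(v ⬝ᵥ v) ^ n) * (ENNReal.ofReal (Real.pi ^ ((k : ℝ) / 2)) *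
        ∫⁻ C : Fin k → Fin k → ℝ,
          ENNReal.ofReal (Real.exp (-∑ i, C i ⬝ᵥ C i) * |det (of C)| ^ n)) := by
  obtain ⟨T, hTm, hT, hTv⟩ := exists_measurePreserving_dotProduct_map_eq_single k v
  let e : (Fin k → Fin (k + 1) → ℝ) ≃ᵐ (Fin k → ℝ) × (Fin k → Fin k → ℝ) :=
    (MeasurableEquiv.piCongrRight fun _ =>
      MeasurableEquiv.piFinSuccAbove (fun _ : Fin (k + 1) => ℝ) 0).trans
      (MeasurableEquiv.arrowProdEquivProdArrow ℝ (Fin k → ℝ) (Fin k))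
  have he : MeasurePreserving e :=
    (volume_measurePreserving_arrowProdEquivProdArrow ℝ (Fin k → ℝ) (Fin k)).comp
      (volume_preserving_pi fun _ => volume_preserving_piFinSuccAbove (fun _ => ℝ) 0)
  have hcons : ∀ W : Fin k → Fin (k + 1) → ℝ,
      |det (of (Fin.cons v W : Fin (k + 1) → Fin (k + 1) → ℝ))| =
        √(v ⬝ᵥ v) * |det (of fun i j => T (W i) (Fin.succ j))| := fun W => by
    rw [← abs_det_map_of_dotProduct_map_eq T hT]
    have h : (fun i => T ((Fin.cons v W : Fin (k + 1) → Fin (k + 1) → ℝ) i)) =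
        Fin.cons (Pi.single 0 √(v ⬝ᵥ v)) fun i => T (W i) := by
      ext i : 1
      refine Fin.cases ?_ (fun i => ?_) i
      · simp [hTv]
      · simp
    rw [h, det_of_cons_single, abs_mul, abs_of_nonneg (Real.sqrt_nonneg _)]
  let F : (Fin k → Fin (k + 1) → ℝ) → ENNReal := fun W =>
    ENNReal.ofReal (√(v ⬝ᵥ v) ^ n) * ENNReal.ofReal (Real.exp (-∑ i, W i ⬝ᵥ W i) *
      |det (of fun i j => W i (Fin.succ j))| ^ n)
  have hF : Measurable F := by fun_prop
  calc
    _ = ∫⁻ W : Fin k → Fin (k + 1) → ℝ, F fun i => T (W i) := by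
      refine lintegral_congr fun W => ?_
      simp only [F, hcons, hT]
      rw [← ENNReal.ofReal_mul (by positivity)]
      congr 1
      ring
    _ = ∫⁻ W, F W := (volume_preserving_pi fun _ : Fin k => hTm).lintegral_comp hF
    _ = ENNReal.ofReal (√(v ⬝ᵥ v) ^ n) * ∫⁻ p : (Fin k → ℝ) × (Fin k → Fin k → ℝ),
        ENNReal.ofReal (Real.exp (-(p.1 ⬝ᵥ p.1))) *
          ENNReal.ofReal (Real.exp (-∑ i, p.2 i ⬝ᵥ p.2 i) * |det (of p.2)| ^ n) := by
      rw [lintegral_const_mul _ (by fun_prop), ← he.lintegral_comp (by fun_prop)]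
      congr 1
      refine lintegral_congr fun W => ?_
      rw [← ENNReal.ofReal_mul (by positivity), ← mul_assoc, ← Real.exp_add, ← neg_add]
      have h1 : (e W).1 = fun i => W i 0 := rfl
      have h2 : (e W).2 = fun i j => W i (Fin.succ j) := rfl
      rw [h1, h2]
      simp only [dotProduct, Fin.sum_univ_succ, Finset.sum_add_distrib]
    _ = _ := by
      rw [Measure.volume_eq_prod,
        lintegral_prod_mul (f := fun x : Fin k → ℝ => ENNReal.ofReal (Real.exp (-(x ⬝ᵥ x))))
          (g := fun C : Fin k → Fin k → ℝ =>
            ENNReal.ofReal (Real.exp (-∑ i, C i ⬝ᵥ C i) * |det (of C)| ^ n))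
          (by fun_prop) (by fun_prop),
        lintegral_exp_neg_dotProduct_self]

theorem lintegral_exp_mul_abs_det (m n : ℕ) :
    ∫⁻ B : Fin m → Fin m → ℝ,
        ENNReal.ofReal (Real.exp (-∑ i, B i ⬝ᵥ B i) * |det (of B)| ^ n) =
      ENNReal.ofReal (Real.pi ^ ((m ^ 2 : ℝ) / 2) *
        ∏ j ∈ Finset.range m,
          Real.Gamma ((n + (j + 1) : ℝ) / 2) / Real.Gamma (((j + 1) : ℝ) / 2)) := by
  induction m with
  | zero => simp [volume_pi]
  | succ k ih =>
    let e := MeasurableEquiv.piFinSuccAbove (fun _ : Fin (k + 1) => Fin (k + 1) → ℝ) 0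
    have he : MeasurePreserving e :=
      volume_preserving_piFinSuccAbove (fun _ : Fin (k + 1) => Fin (k + 1) → ℝ) 0
    have hsymm : ∀ p : (Fin (k + 1) → ℝ) × (Fin k → Fin (k + 1) → ℝ),
        e.symm p = Fin.cons p.1 p.2 := fun p => by
      simp [e, MeasurableEquiv.piFinSuccAbove, Fin.insertNthEquiv]
    have hmeas : Measurable fun B : Fin (k + 1) → Fin (k + 1) → ℝ =>
        ENNReal.ofReal (Real.exp (-∑ i, B i ⬝ᵥ B i) * |det (of B)| ^ n) := by fun_prop
    rw [← he.symm.lintegral_comp hmeas, Measure.volume_eq_prod,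
      lintegral_prod _ (by exact (hmeas.comp e.symm.measurable).aemeasurable)]
    have hinner : ∀ v : Fin (k + 1) → ℝ,
        ∫⁻ W : Fin k → Fin (k + 1) → ℝ,
          ENNReal.ofReal (Real.exp (-∑ i, e.symm (v, W) i ⬝ᵥ e.symm (v, W) i) *
            |det (of (e.symm (v, W)))| ^ n) =
        ENNReal.ofReal (Real.exp (-(v ⬝ᵥ v)) * √(v ⬝ᵥ v) ^ n) *
          (ENNReal.ofReal (Real.pi ^ ((k : ℝ) / 2)) *
            ∫⁻ C : Fin k → Fin k → ℝ,
              ENNReal.ofReal (Real.exp (-∑ i, C i ⬝ᵥ C i) * |det (of C)| ^ n)) := fun v => by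
      rw [ENNReal.ofReal_mul (by positivity), mul_assoc, ← lintegral_exp_mul_abs_det_cons,
        ← lintegral_const_mul' _ _ ENNReal.ofReal_ne_top]
      refine lintegral_congr fun W => ?_
      rw [hsymm, ← ENNReal.ofReal_mul (by positivity), ← mul_assoc, ← Real.exp_add, ← neg_add,
        Fin.sum_univ_succ]
      simp
    simp_rw [hinner]
    have hprod : 0 ≤ ∏ j ∈ Finset.range k,
        Real.Gamma ((n + (j + 1) : ℝ) / 2) / Real.Gamma (((j + 1) : ℝ) / 2) :=
      Finset.prod_nonneg fun j _ => div_nonneg (Real.Gamma_nonneg_of_nonneg (by positivity))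
        (Real.Gamma_nonneg_of_nonneg (by positivity))
    rw [lintegral_mul_const _ (by fun_prop), lintegral_exp_neg_dotProduct_self_mul_sqrt_pow, ih,
      ← ENNReal.ofReal_mul (by positivity), ← ENNReal.ofReal_mul' (by positivity),
      Finset.prod_range_succ]
    congr 1
    have hpow : Real.pi ^ (((k + 1 : ℕ) ^ 2 : ℝ) / 2) = Real.pi ^ ((k + 1 : ℝ) / 2) *
        Real.pi ^ ((k : ℝ) / 2) * Real.pi ^ ((k ^ 2 : ℝ) / 2) := by
      rw [← Real.rpow_add Real.pi_pos, ← Real.rpow_add Real.pi_pos]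
      congr 1
      push_cast
      ring
    rw [hpow]
    ring

theorem prod_range_div_eq_prod_range_div (g : ℕ → ℝ) (hg : ∀ j, g j ≠ 0) (m n : ℕ) :
    ∏ j ∈ Finset.range n, g (m + j) / g j = ∏ j ∈ Finset.range m, g (n + j) / g j := by
  have hprod : ∀ s : Finset ℕ, ∏ j ∈ s, g j ≠ 0 := fun s => Finset.prod_ne_zero_iff.2 fun j _ => hg j
  rw [Finset.prod_div_distrib, Finset.prod_div_distrib, div_eq_div_iff (hprod _) (hprod _),
    mul_comm, ← Finset.prod_range_add, mul_comm, ← Finset.prod_range_add, add_comm]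

/-- Gaussian matrix integral:
`∫ e^{-tr B Bᵀ} |det B|ⁿ dB = π^(m²/2) ∏_{j=1}^n Γ((m+j)/2)/Γ(j/2)
 = π^(m²/2) ∏_{j=1}^m Γ((n+j)/2)/Γ(j/2)`. -/
theorem gaussian_det_integral (m n : ℕ) (hm : 1 ≤ m) (hn : 1 ≤ n) :
    (∫⁻ B : Fin m → Fin m → ℝ,
        ENNReal.ofReal (Real.exp (-Matrix.trace (Matrix.of B * (Matrix.of B)ᵀ)) *
          |Matrix.det (Matrix.of B)| ^ n))
      = ENNReal.ofReal (Real.pi ^ ((m ^ 2 : ℝ) / 2) *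
          ∏ j ∈ Finset.range n,
            Real.Gamma ((m + (j + 1) : ℝ) / 2) / Real.Gamma (((j + 1) : ℝ) / 2)) ∧
    Real.pi ^ ((m ^ 2 : ℝ) / 2) *
        (∏ j ∈ Finset.range n,
          Real.Gamma ((m + (j + 1) : ℝ) / 2) / Real.Gamma (((j + 1) : ℝ) / 2))
      = Real.pi ^ ((m ^ 2 : ℝ) / 2) *
        ∏ j ∈ Finset.range m,
          Real.Gamma ((n + (j + 1) : ℝ) / 2) / Real.Gamma (((j + 1) : ℝ) / 2) := by
  have hsymm := prod_range_div_eq_prod_range_div (fun j => Real.Gamma (((j : ℝ) + 1) / 2))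
    (fun j => (Real.Gamma_pos_of_pos (by positivity)).ne') m n
  simp only [Nat.cast_add, add_assoc] at hsymm
  rw [hsymm]
  exact ⟨lintegral_exp_mul_abs_det m n, rfl⟩
end

section
/- For every integer m ≥ 1, the integral over ℝ^m of ∏_{1≤i<j≤m} |ω_i² − ω_j²| · exp(−(1/2)·∑_{i=1}^{m} ω_i²) with respect to Lebesgue measure dω₁…dω_m equals (2π)^(m²/2) · 2^m · ∏_{j=1}^{m} Γ(1 + j/2) · Γ(j/2) · π^(−m(m+1)/2). -/
open MeasureTheory
open scoped ENNReal Real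

/-- The Euler factor `x ^ (a - 1) * exp (-x)` taken over all coordinates. -/
noncomputable def laguerreWeight {n : ℕ} (a : ℝ) (x : Fin n → ℝ) : ℝ :=
  ∏ i, (x i ^ (a - 1) * Real.exp (-x i))

/-- The absolute value of the Vandermonde determinant. -/
noncomputable def absVandermonde {n : ℕ} (x : Fin n → ℝ) : ℝ :=
  |(Matrix.vandermonde x).det|

/-- Lebesgue measure on the positive orthant. -/
noncomputable def orthantMeasure (n : ℕ) : Measure (Fin n → ℝ) :=
  Measure.pi fun _ => volume.restrict (Set.Ioi 0)

instance (n : ℕ) : SigmaFinite (orthantMeasure n) := by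
  unfold orthantMeasure; infer_instance

/-- The Selberg integral of Laguerre type with exponent `1 / 2` of the squared Vandermonde. -/
noncomputable def laguerreSelberg (n : ℕ) (a : ℝ) : ℝ :=
  ∫ x, absVandermonde x * laguerreWeight a x ∂orthantMeasure n

lemma ae_orthantMeasure_pos (n : ℕ) : ∀ᵐ x ∂orthantMeasure n, ∀ i, 0 < x i := by
  have h : ∀ i : Fin n, ∀ᵐ x ∂orthantMeasure n, 0 < x i := fun i =>
    (Measure.quasiMeasurePreserving_eval (fun _ : Fin n => volume.restrict (Set.Ioi (0 : ℝ)))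
      i).ae (ae_restrict_mem measurableSet_Ioi)
  exact ae_all_iff.2 h

lemma measurable_laguerreWeight {n : ℕ} (a : ℝ) :
    Measurable (laguerreWeight a : (Fin n → ℝ) → ℝ) := by
  unfold laguerreWeight; fun_prop

lemma measurable_absVandermonde {n : ℕ} : Measurable (absVandermonde : (Fin n → ℝ) → ℝ) := by
  unfold absVandermonde
  simp only [Matrix.det_vandermonde]
  fun_prop

lemma absVandermonde_nonneg {n : ℕ} (x : Fin n → ℝ) : 0 ≤ absVandermonde x := abs_nonneg _

lemma absVandermonde_comp_perm {n : ℕ} (σ : Equiv.Perm (Fin n)) (x : Fin n → ℝ) :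
    absVandermonde (x ∘ σ) = absVandermonde x := by
  have h : Matrix.vandermonde (x ∘ σ) = (Matrix.vandermonde x).submatrix σ id := rfl
  rw [absVandermonde, h, Matrix.det_permute]
  rcases Int.units_eq_one_or (Equiv.Perm.sign σ) with h | h <;> simp [h, absVandermonde]

lemma laguerreWeight_comp_perm {n : ℕ} (a : ℝ) (σ : Equiv.Perm (Fin n)) (x : Fin n → ℝ) :
    laguerreWeight a (x ∘ σ) = laguerreWeight a x :=
  Equiv.prod_comp σ fun i => x i ^ (a - 1) * Real.exp (-x i)

lemma integral_comp_perm {n : ℕ} (σ : Equiv.Perm (Fin n)) (F : (Fin n → ℝ) → ℝ) :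
    ∫ x, F (x ∘ σ) ∂orthantMeasure n = ∫ x, F x ∂orthantMeasure n := by
  have h := measurePreserving_piCongrLeft
    (fun _ : Fin n => volume.restrict (Set.Ioi (0 : ℝ))) σ.symm
  have h2 := h.integral_comp' F
  convert! h2 using 3 with x
  congr 1
  ext i
  rw [← σ.symm_apply_apply i, MeasurableEquiv.piCongrLeft_apply_apply]
  simp

lemma absVandermonde_insertNth {n : ℕ} (k : Fin (n + 1)) (t : ℝ) (y : Fin n → ℝ) :
    absVandermonde (k.insertNth t y : Fin (n + 1) → ℝ) =
      (∏ i, |t - y i|) * absVandermonde y := by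
  rw [← absVandermonde_comp_perm k.cycleRange.symm, Fin.insertNth_comp_cycleRange_symm]
  simp only [absVandermonde, Matrix.det_vandermonde, Fin.prod_univ_succ, Fin.prod_Ioi_zero,
    Fin.prod_Ioi_succ, Fin.cons_zero, Fin.cons_succ, abs_mul, Finset.abs_prod]
  simp only [abs_sub_comm t]

lemma absVandermonde_eq_prod_removeNth {n : ℕ} (k : Fin (n + 1)) (x : Fin (n + 1) → ℝ) :
    absVandermonde x =
      (∏ i, |x k - x (k.succAbove i)|) * absVandermonde (k.removeNth x) := by
  conv_lhs => rw [← Fin.insertNth_self_removeNth k x, absVandermonde_insertNth]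
  rfl

lemma laguerreWeight_eq_mul_removeNth {n : ℕ} (a : ℝ) (k : Fin (n + 1)) (x : Fin (n + 1) → ℝ) :
    laguerreWeight a x =
      x k ^ (a - 1) * Real.exp (-x k) * laguerreWeight a (k.removeNth x) := by
  rw [laguerreWeight, Fin.prod_univ_succAbove _ k]; rfl

/-! ### Integrability -/

lemma one_le_prod_one_add_abs {n : ℕ} (x : Fin n → ℝ) : 1 ≤ ∏ i, (1 + |x i|) :=
  Finset.one_le_prod fun i _ => by linarith [abs_nonneg (x i)]

lemma abs_sub_le_prod {n : ℕ} (x : Fin n → ℝ) {i j : Fin n} (h : i ≠ j) :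
    |x i - x j| ≤ ∏ l, (1 + |x l|) := by
  rw [← Finset.mul_prod_erase _ _ (Finset.mem_univ i),
    ← Finset.mul_prod_erase _ _ (Finset.mem_erase.2 ⟨h.symm, Finset.mem_univ j⟩), ← mul_assoc]
  refine le_trans ?_ (le_mul_of_one_le_right (by positivity)
    (Finset.one_le_prod fun i _ => by linarith [abs_nonneg (x i)]))
  nlinarith [abs_sub (x i) (x j), abs_nonneg (x i), abs_nonneg (x j),
    mul_nonneg (abs_nonneg (x i)) (abs_nonneg (x j))]

lemma absVandermonde_le {n : ℕ} (x : Fin n → ℝ) :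
    absVandermonde x ≤ (∏ i, (1 + |x i|)) ^ (n * n) := by
  have hB := one_le_prod_one_add_abs x
  rw [absVandermonde, Matrix.det_vandermonde, Finset.abs_prod, pow_mul]
  calc ∏ i, |∏ j ∈ Finset.Ioi i, (x j - x i)|
      ≤ ∏ _i : Fin n, (∏ i, (1 + |x i|)) ^ n := by
        refine Finset.prod_le_prod (fun _ _ => abs_nonneg _) fun i _ => ?_
        rw [Finset.abs_prod]
        calc ∏ j ∈ Finset.Ioi i, |x j - x i|
            ≤ ∏ j ∈ Finset.Ioi i, ∏ i, (1 + |x i|) :=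
              Finset.prod_le_prod (fun _ _ => abs_nonneg _) fun j hj =>
                abs_sub_le_prod x (Finset.mem_Ioi.1 hj).ne'
          _ ≤ _ := by
              rw [Finset.prod_const]
              exact pow_le_pow_right₀ hB ((Finset.card_le_univ _).trans (by simp))
    _ = _ := by simp

lemma absVandermonde_div_le {n : ℕ} (x : Fin n → ℝ) (k j : Fin n) :
    absVandermonde x / |x k - x j| ≤ (∏ i, (1 + |x i|)) ^ (n + n * n) := by
  have hB := one_le_prod_one_add_abs x
  rcases eq_or_ne (x k) (x j) with h | h
  · simp only [h, sub_self, abs_zero, div_zero]; positivity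
  have hkj : j ≠ k := fun e => h (by rw [e])
  obtain _ | n := n
  · exact k.elim0
  obtain ⟨i, rfl⟩ := Fin.exists_succAbove_eq hkj
  rw [div_le_iff₀ (abs_pos.2 (sub_ne_zero.2 h)), absVandermonde_eq_prod_removeNth k,
    ← Finset.mul_prod_erase _ _ (Finset.mem_univ i), mul_assoc, mul_comm]
  refine mul_le_mul_of_nonneg_right ?_ (abs_nonneg _)
  rw [pow_add]
  refine mul_le_mul ?_ ?_ (absVandermonde_nonneg _) (by positivity)
  · calc ∏ l ∈ Finset.univ.erase i, |x k - x (k.succAbove l)|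
        ≤ ∏ l ∈ Finset.univ.erase i, ∏ i, (1 + |x i|) :=
          Finset.prod_le_prod (fun _ _ => abs_nonneg _) fun j hj =>
            abs_sub_le_prod x (Fin.succAbove_ne k j).symm
      _ ≤ _ := by
          rw [Finset.prod_const]
          exact pow_le_pow_right₀ hB ((Finset.card_le_univ _).trans (by simp))
  · refine (absVandermonde_le _).trans ?_
    calc (∏ i, (1 + |k.removeNth x i|)) ^ (n * n)
        ≤ (∏ i, (1 + |x i|)) ^ (n * n) := by
          refine pow_le_pow_left₀ (Finset.prod_nonneg fun _ _ => by positivity) ?_ _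
          rw [Fin.prod_univ_succAbove _ k]
          exact le_mul_of_one_le_left (Finset.prod_nonneg fun _ _ => by positivity)
            (by linarith [abs_nonneg (x k)])
      _ ≤ _ := pow_le_pow_right₀ hB (by gcongr <;> omega)

lemma integrableOn_one_add_pow_mul (N : ℕ) {a : ℝ} (ha : 0 < a) :
    IntegrableOn (fun x : ℝ => (1 + |x|) ^ N * (x ^ (a - 1) * Real.exp (-x))) (Set.Ioi 0) := by
  induction N generalizing a with
  | zero => simpa [mul_comm] using Real.GammaIntegral_convergent ha
  | succ N ih =>
    refine ((ih ha).add (ih (a := a + 1) (by linarith))).congr_fun ?_ measurableSet_Ioi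
    intro x hx
    have hx' : 0 < x := hx
    have : x ^ (a + 1 - 1) = x ^ (a - 1) * x := by
      rw [show a + 1 - 1 = a - 1 + 1 by ring, Real.rpow_add_one hx'.ne']
    simp only [Pi.add_apply, this, abs_of_pos hx']
    ring

lemma integrable_mul_laguerreWeight {n : ℕ} {a : ℝ} (ha : 0 < a) {F : (Fin n → ℝ) → ℝ}
    (hF : Measurable F) (N : ℕ) (hN : ∀ x, |F x| ≤ (∏ i, (1 + |x i|)) ^ N) :
    Integrable (fun x => F x * laguerreWeight a x) (orthantMeasure n) := by
  have h : Integrable (fun x : Fin n → ℝ => ∏ i, ((1 + |x i|) ^ N *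
      (x i ^ (a - 1) * Real.exp (-x i)))) (orthantMeasure n) :=
    Integrable.fintype_prod (fun _ => integrableOn_one_add_pow_mul N ha)
  refine h.mono' (hF.mul (measurable_laguerreWeight a)).aestronglyMeasurable ?_
  filter_upwards [ae_orthantMeasure_pos n] with x hx
  have hw : 0 ≤ laguerreWeight a x :=
    Finset.prod_nonneg fun i _ => mul_nonneg (Real.rpow_nonneg (hx i).le _) (Real.exp_pos _).le
  rw [Real.norm_eq_abs, abs_mul, abs_of_nonneg hw, Finset.prod_mul_distrib, Finset.prod_pow]
  exact mul_le_mul_of_nonneg_right (hN x) hw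

/-! ### Integration by parts -/

lemma hasDerivAt_prod_abs_sub {ι : Type*} (s : Finset ι) (y : ι → ℝ) (t : ℝ)
    (h : ∀ i ∈ s, t ≠ y i) :
    HasDerivAt (fun t => ∏ i ∈ s, |t - y i|)
      ((∑ i ∈ s, 1 / (t - y i)) * ∏ i ∈ s, |t - y i|) t := by
  classical
  induction s using Finset.induction_on with
  | empty => simpa using hasDerivAt_const t (1 : ℝ)
  | insert i s hi ih =>
    have hne : t - y i ≠ 0 := sub_ne_zero.2 (h i (Finset.mem_insert_self _ _))
    have h1 : HasDerivAt (fun t => |t - y i|) (1 / (t - y i) * |t - y i|) t := by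
      convert! (hasDerivAt_abs hne).comp t ((hasDerivAt_id t).sub_const (y i)) using 1
      rcases lt_or_gt_of_ne hne with h0 | h0
      · simp only [h0, abs_of_neg, sign_neg]
        field_simp
        simp
      · simp [h0, abs_of_pos, h0.ne']
    have h2 := h1.mul (ih fun j hj => h j (Finset.mem_insert_of_mem hj))
    simp only [Finset.prod_insert hi, Finset.sum_insert hi]
    convert! h2 using 1
    ring

lemma tendsto_rpow_mul_exp_neg_mul_prod_abs_sub {n : ℕ} (b : ℝ) (y : Fin n → ℝ) :
    Filter.Tendsto (fun t => t ^ b * Real.exp (-t) * ∏ i, |t - y i|) Filter.atTop (nhds 0) := by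
  have h := (tendsto_rpow_mul_exp_neg_mul_atTop_nhds_zero (b + n) 1 one_pos).mul_const
    (∏ i, (1 + |y i|))
  rw [zero_mul] at h
  refine squeeze_zero' ?_ ?_ h
  · filter_upwards [Filter.eventually_ge_atTop 0] with t ht
    positivity
  · filter_upwards [Filter.eventually_ge_atTop 1] with t ht
    have ht0 : 0 < t := by linarith
    have hle : ∏ i, |t - y i| ≤ t ^ n * ∏ i, (1 + |y i|) := by
      calc ∏ i, |t - y i| ≤ ∏ i, (t * (1 + |y i|)) := by
            refine Finset.prod_le_prod (fun _ _ => abs_nonneg _) fun i _ => ?_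
            have := abs_sub t (y i)
            rw [abs_of_pos ht0] at this
            nlinarith [abs_nonneg (y i)]
        _ = _ := by simp [Finset.prod_mul_distrib]
    rw [Real.rpow_add_natCast ht0.ne', neg_one_mul]
    calc t ^ b * Real.exp (-t) * ∏ i, |t - y i|
        ≤ t ^ b * Real.exp (-t) * (t ^ n * ∏ i, (1 + |y i|)) := by gcongr
      _ = _ := by ring

lemma integral_Ioi_deriv_rpow_mul_exp_mul_prod_abs_sub {n : ℕ} {b : ℝ} (hb : 0 ≤ b)
    (y : Fin n → ℝ) (c : ℝ)
    (hint : IntegrableOn (fun t : ℝ => (b * t ^ (b - 1) - t ^ b + ∑ i, t ^ b / (t - y i)) *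
      Real.exp (-t) * (∏ i, |t - y i|) * c) (Set.Ioi 0)) :
    ∫ t in Set.Ioi (0 : ℝ), (b * t ^ (b - 1) - t ^ b + ∑ i, t ^ b / (t - y i)) *
      Real.exp (-t) * (∏ i, |t - y i|) * c = -((0 : ℝ) ^ b * (∏ i, |y i|) * c) := by
  set G : ℝ → ℝ := fun t => t ^ b * Real.exp (-t) * (∏ i, |t - y i|) * c with hG
  have hcont : Continuous G := by
    have := Real.continuous_rpow_const hb
    fun_prop
  have hderiv : ∀ t : ℝ, 0 < t → t ∉ Set.range y → HasDerivAt G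
      ((b * t ^ (b - 1) - t ^ b + ∑ i, t ^ b / (t - y i)) *
        Real.exp (-t) * (∏ i, |t - y i|) * c) t := by
    intro t ht hty
    have h1 := Real.hasDerivAt_rpow_const (x := t) (p := b) (Or.inl ht.ne')
    have h2 : HasDerivAt (fun t : ℝ => Real.exp (-t)) (-Real.exp (-t)) t := by
      simpa using (hasDerivAt_neg t).exp
    have h3 := hasDerivAt_prod_abs_sub Finset.univ y t
      (fun i _ e => hty ⟨i, e.symm⟩)
    convert! ((h1.mul h2).mul h3).mul_const c using 1
    simp only [div_eq_mul_one_div (t ^ b), ← Finset.mul_sum, Pi.mul_apply]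
    ring
  have hlim : Filter.Tendsto G Filter.atTop (nhds 0) := by
    simpa using (tendsto_rpow_mul_exp_neg_mul_prod_abs_sub b y).mul_const c
  have hI := intervalIntegral_tendsto_integral_Ioi 0 hint Filter.tendsto_id
  have hI2 : Filter.Tendsto (fun T : ℝ => G T - G 0) Filter.atTop (nhds (0 - G 0)) :=
    hlim.sub_const _
  have hEq := tendsto_nhds_unique (hI.congr' ?_) hI2
  · rw [hEq]
    simp [hG]
  · filter_upwards [Filter.eventually_ge_atTop 0] with T hT
    refine integral_eq_of_hasDerivAt_off_countable_of_le G _ hT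
      (Set.countable_range y) hcont.continuousOn (fun t ht => hderiv t ht.1.1 ht.2) ?_
    exact (intervalIntegrable_iff_integrableOn_Ioc_of_le hT).2 <| hint.mono_set Set.Ioc_subset_Ioi_self

/-- Integration by parts in one coordinate over the orthant. -/
lemma integral_orthant_deriv {n : ℕ} (k : Fin (n + 1)) {b : ℝ} (hb : 0 ≤ b)
    (H : (Fin n → ℝ) → ℝ)
    (hint : Integrable (fun x : Fin (n + 1) → ℝ =>
      (b * x k ^ (b - 1) - x k ^ b + ∑ i, x k ^ b / (x k - x (k.succAbove i))) *
      Real.exp (-x k) * (∏ i, |x k - x (k.succAbove i)|) * H (k.removeNth x))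
      (orthantMeasure (n + 1))) :
    ∫ x : Fin (n + 1) → ℝ,
      (b * x k ^ (b - 1) - x k ^ b + ∑ i, x k ^ b / (x k - x (k.succAbove i))) *
      Real.exp (-x k) * (∏ i, |x k - x (k.succAbove i)|) * H (k.removeNth x)
      ∂orthantMeasure (n + 1) =
    -((0 : ℝ) ^ b * ∫ y, (∏ i, |y i|) * H y ∂orthantMeasure n) := by
  have hmp := measurePreserving_piFinSuccAbove
    (fun _ : Fin (n + 1) => volume.restrict (Set.Ioi (0 : ℝ))) k
  set F : ℝ × (Fin n → ℝ) → ℝ := fun p =>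
    (b * p.1 ^ (b - 1) - p.1 ^ b + ∑ i, p.1 ^ b / (p.1 - p.2 i)) *
      Real.exp (-p.1) * (∏ i, |p.1 - p.2 i|) * H p.2
  have hF : Integrable F ((volume.restrict (Set.Ioi (0 : ℝ))).prod (orthantMeasure n)) :=
    (hmp.integrable_comp_emb (MeasurableEquiv.measurableEmbedding _)).1 hint
  have h1 : ∫ x, F (MeasurableEquiv.piFinSuccAbove (fun _ => ℝ) k x) ∂orthantMeasure (n + 1)
      = ∫ p, F p ∂((volume.restrict (Set.Ioi (0 : ℝ))).prod (orthantMeasure n)) :=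
    hmp.integral_comp' F
  refine h1.trans ?_
  rw [integral_prod_symm _ hF, ← integral_const_mul, ← integral_neg]
  refine integral_congr_ae ?_
  filter_upwards [hF.prod_left_ae] with y hy
  rw [integral_Ioi_deriv_rpow_mul_exp_mul_prod_abs_sub hb y (H y) hy, mul_assoc]

/-! ### Aomoto's recursion -/

lemma abs_prod_le_prod_one_add_abs {n : ℕ} (S : Finset (Fin n)) (x : Fin n → ℝ) :
    |∏ i ∈ S, x i| ≤ ∏ i, (1 + |x i|) := by
  rw [Finset.abs_prod, ← Finset.prod_sdiff (Finset.subset_univ S)]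
  calc ∏ i ∈ S, |x i| ≤ ∏ i ∈ S, (1 + |x i|) :=
        Finset.prod_le_prod (fun _ _ => abs_nonneg _) fun i _ => by linarith
    _ ≤ _ := le_mul_of_one_le_left (Finset.prod_nonneg fun _ _ => by positivity)
        (Finset.one_le_prod fun i _ => by linarith [abs_nonneg (x i)])

lemma integrable_prod_mul_absVandermonde {n : ℕ} {a : ℝ} (ha : 0 < a) (S : Finset (Fin n)) :
    Integrable (fun x => (∏ i ∈ S, x i) * absVandermonde x * laguerreWeight a x)
      (orthantMeasure n) := by
  have hV := measurable_absVandermonde (n := n)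
  refine integrable_mul_laguerreWeight ha (by fun_prop) (1 + n * n) fun x => ?_
  rw [abs_mul, abs_of_nonneg (absVandermonde_nonneg x), pow_add, pow_one]
  exact mul_le_mul (abs_prod_le_prod_one_add_abs S x) (absVandermonde_le x)
    (absVandermonde_nonneg x) (Finset.prod_nonneg fun _ _ => by positivity)

lemma integrable_prod_mul_absVandermonde_div {n : ℕ} {a : ℝ} (ha : 0 < a) (S : Finset (Fin n))
    (k j : Fin n) :
    Integrable (fun x => (∏ i ∈ S, x i) * (absVandermonde x / (x k - x j)) * laguerreWeight a x)
      (orthantMeasure n) := by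
  have hV := measurable_absVandermonde (n := n)
  refine integrable_mul_laguerreWeight ha (by fun_prop) (1 + (n + n * n)) fun x => ?_
  rw [abs_mul, abs_div, abs_of_nonneg (absVandermonde_nonneg x), pow_add, pow_one]
  exact mul_le_mul (abs_prod_le_prod_one_add_abs S x) (absVandermonde_div_le x k j)
    (div_nonneg (absVandermonde_nonneg x) (abs_nonneg _))
    (Finset.prod_nonneg fun _ _ => by positivity)

lemma integral_prod_mul_absVandermonde_div_eq_zero {n : ℕ} (a : ℝ) (S : Finset (Fin n))
    {k j : Fin n} (h : k ∈ S ↔ j ∈ S) :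
    ∫ x, (∏ i ∈ S, x i) * (absVandermonde x / (x k - x j)) * laguerreWeight a x
      ∂orthantMeasure n = 0 := by
  have hS : ∀ x : Fin n → ℝ, ∏ i ∈ S, x (Equiv.swap k j i) = ∏ i ∈ S, x i := by
    intro x
    refine Finset.prod_equiv (Equiv.swap k j) (fun i => ?_) fun _ _ => rfl
    rcases eq_or_ne i k with rfl | hik
    · simpa using h
    rcases eq_or_ne i j with rfl | hij
    · simpa using h.symm
    rw [Equiv.swap_apply_of_ne_of_ne hik hij]
  have := integral_comp_perm (Equiv.swap k j) fun x =>
    (∏ i ∈ S, x i) * (absVandermonde x / (x k - x j)) * laguerreWeight a x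
  simp only [absVandermonde_comp_perm, laguerreWeight_comp_perm, Function.comp_apply, hS,
    Equiv.swap_apply_left, Equiv.swap_apply_right] at this
  have hneg : ∀ x : Fin n → ℝ,
      (∏ i ∈ S, x i) * (absVandermonde x / (x j - x k)) * laguerreWeight a x =
      -((∏ i ∈ S, x i) * (absVandermonde x / (x k - x j)) * laguerreWeight a x) := by
    intro x
    rw [← neg_sub (x k) (x j), div_neg]
    ring
  simp only [hneg, integral_neg] at this
  linarith

lemma absVandermonde_eq_zero {n : ℕ} {x : Fin n → ℝ} {k j : Fin n} (hkj : k ≠ j)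
    (h : x k = x j) : absVandermonde x = 0 := by
  rw [absVandermonde, abs_eq_zero, Matrix.det_vandermonde_eq_zero_iff]
  exact ⟨k, j, h, hkj⟩

lemma integral_prod_insert_mul_absVandermonde_div {n : ℕ} {a : ℝ} (ha : 0 < a)
    (S : Finset (Fin n)) {k j : Fin n} (hkj : k ≠ j) (hk : k ∉ S) (hj : j ∉ S) :
    ∫ x, (∏ i ∈ insert k S, x i) * (absVandermonde x / (x k - x j)) * laguerreWeight a x
      ∂orthantMeasure n =
    (∫ x, (∏ i ∈ S, x i) * absVandermonde x * laguerreWeight a x ∂orthantMeasure n) / 2 := by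
  have hS : ∀ x : Fin n → ℝ, ∏ i ∈ S, x (Equiv.swap k j i) = ∏ i ∈ S, x i := by
    intro x
    refine Finset.prod_congr rfl fun i hi => ?_
    rw [Equiv.swap_apply_of_ne_of_ne (by rintro rfl; exact hk hi) (by rintro rfl; exact hj hi)]
  have h1 := integral_comp_perm (Equiv.swap k j) fun x =>
    (∏ i ∈ insert k S, x i) * (absVandermonde x / (x k - x j)) * laguerreWeight a x
  have hint := integrable_prod_mul_absVandermonde_div ha (insert k S) k j
  have hint' := integrable_prod_mul_absVandermonde_div ha (insert j S) j k
  simp only [absVandermonde_comp_perm, laguerreWeight_comp_perm, Function.comp_apply,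
    Finset.prod_insert hk, hS, Equiv.swap_apply_left, Equiv.swap_apply_right] at h1 hint ⊢
  simp only [Finset.prod_insert hj] at hint'
  have h2 : ∀ x : Fin n → ℝ, (∏ i ∈ S, x i) * absVandermonde x * laguerreWeight a x =
      x k * (∏ i ∈ S, x i) * (absVandermonde x / (x k - x j)) * laguerreWeight a x +
      x j * (∏ i ∈ S, x i) * (absVandermonde x / (x j - x k)) * laguerreWeight a x := by
    intro x
    rcases eq_or_ne (x k) (x j) with h | h
    · simp [absVandermonde_eq_zero hkj h]
    · have h0 := sub_ne_zero.2 h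
      rw [← neg_sub (x k) (x j)]
      field_simp
      ring
  rw [integral_congr_ae (Filter.Eventually.of_forall h2), integral_add hint hint', h1]
  ring

lemma integral_prod_insert_mul_absVandermonde {n : ℕ} {a : ℝ} (ha : 0 < a)
    (S : Finset (Fin (n + 1))) {k : Fin (n + 1)} (hk : k ∉ S) :
    ∫ x, (∏ i ∈ insert k S, x i) * absVandermonde x * laguerreWeight a x
      ∂orthantMeasure (n + 1) =
    (a + (n - S.card) / 2) *
      ∫ x, (∏ i ∈ S, x i) * absVandermonde x * laguerreWeight a x ∂orthantMeasure (n + 1) := by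
  set H : (Fin n → ℝ) → ℝ := fun y =>
    (∏ i, if k.succAbove i ∈ S then y i else 1) * absVandermonde y * laguerreWeight a y with hH
  have hS : ∀ x : Fin (n + 1) → ℝ,
      (∏ i, if k.succAbove i ∈ S then (k.removeNth x) i else 1) = ∏ i ∈ S, x i := by
    intro x
    rw [← Finset.prod_ite_mem_eq S, Fin.prod_univ_succAbove _ k, if_neg hk, one_mul]
    rfl
  have hI := integrable_prod_mul_absVandermonde ha S
  have hI' := integrable_prod_mul_absVandermonde ha (insert k S)
  have hQ : ∀ i ∈ Finset.univ, Integrable _ _ := fun (i : Fin n) _ =>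
    integrable_prod_mul_absVandermonde_div ha (insert k S) k (k.succAbove i)
  have hsum := ((hI.const_mul a).sub hI').add (integrable_finsetSum Finset.univ hQ)
  have hae : (fun x : Fin (n + 1) → ℝ =>
      (a * x k ^ (a - 1) - x k ^ a + ∑ i, x k ^ a / (x k - x (k.succAbove i))) *
      Real.exp (-x k) * (∏ i, |x k - x (k.succAbove i)|) * H (k.removeNth x))
      =ᵐ[orthantMeasure (n + 1)] fun x =>
      (a * ((∏ i ∈ S, x i) * absVandermonde x * laguerreWeight a x) -
        (∏ i ∈ insert k S, x i) * absVandermonde x * laguerreWeight a x) +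
      ∑ i : Fin n, (∏ i ∈ insert k S, x i) *
        (absVandermonde x / (x k - x (k.succAbove i))) * laguerreWeight a x := by
    filter_upwards [ae_orthantMeasure_pos (n + 1)] with x hx
    have hpow : x k ^ a = x k ^ (a - 1) * x k := by
      rw [← Real.rpow_add_one (hx k).ne', sub_add_cancel]
    simp only [hH, hS, Finset.prod_insert hk, hpow, div_eq_mul_inv, ← Finset.mul_sum,
      ← Finset.sum_mul]
    rw [laguerreWeight_eq_mul_removeNth a k x, absVandermonde_eq_prod_removeNth k x]
    ring
  have hibp := integral_orthant_deriv k ha.le H (hsum.congr hae.symm)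
  rw [integral_congr_ae hae, Real.zero_rpow ha.ne', zero_mul, neg_zero] at hibp
  replace hibp := (integral_add ((hI.const_mul a).sub hI')
    (integrable_finsetSum Finset.univ hQ)).symm.trans hibp
  rw [integral_sub' (hI.const_mul a) hI', integral_const_mul, integral_finsetSum _ hQ] at hibp
  set A := ∫ x, (∏ i ∈ S, x i) * absVandermonde x * laguerreWeight a x ∂orthantMeasure (n + 1)
  have hval : ∀ i : Fin n, ∫ x, (∏ i ∈ insert k S, x i) *
        (absVandermonde x / (x k - x (k.succAbove i))) * laguerreWeight a x
        ∂orthantMeasure (n + 1) = if k.succAbove i ∈ S then 0 else A / 2 := by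
    intro i
    split_ifs with h
    · exact integral_prod_mul_absVandermonde_div_eq_zero a _ (by simp [h])
    · exact integral_prod_insert_mul_absVandermonde_div ha S (Fin.succAbove_ne k i).symm hk h
  have hcount : ∑ i : Fin n, (if k.succAbove i ∈ S then 0 else A / 2) =
      (n - S.card) * (A / 2) := by
    have h1 := Fin.sum_univ_succAbove (fun j => if j ∈ S then 0 else A / 2) k
    rw [if_neg hk] at h1
    have h2 : ∑ j, (if j ∈ S then 0 else A / 2) = (n + 1 - S.card) * (A / 2) := by
      have h3 : ∀ j, (if j ∈ S then 0 else A / 2) = A / 2 - if j ∈ S then A / 2 else 0 := by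
        intro j; split_ifs <;> simp
      simp only [h3, Finset.sum_sub_distrib, Finset.sum_ite_mem]
      simp
      ring
    linarith
  simp only [hval, hcount] at hibp
  linarith

lemma integral_prod_mul_absVandermonde {n : ℕ} {a : ℝ} (ha : 0 < a) (S : Finset (Fin (n + 1))) :
    ∫ x, (∏ i ∈ S, x i) * absVandermonde x * laguerreWeight a x ∂orthantMeasure (n + 1) =
      (∏ r ∈ Finset.range S.card, (a + ((n : ℝ) - r) / 2)) * laguerreSelberg (n + 1) a := by
  induction S using Finset.induction_on with
  | empty => simp [laguerreSelberg]
  | insert k S hk ih =>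
    rw [integral_prod_insert_mul_absVandermonde ha S hk, ih, Finset.card_insert_of_notMem hk,
      Finset.prod_range_succ]
    ring

lemma integral_prod_abs_mul_absVandermonde (n : ℕ) (a : ℝ) :
    ∫ x, (∏ i, |x i|) * (absVandermonde x * laguerreWeight a x) ∂orthantMeasure n =
      laguerreSelberg n (a + 1) := by
  refine integral_congr_ae ?_
  filter_upwards [ae_orthantMeasure_pos n] with x hx
  have : laguerreWeight (a + 1) x = (∏ i, |x i|) * laguerreWeight a x := by
    rw [laguerreWeight, laguerreWeight, ← Finset.prod_mul_distrib]
    refine Finset.prod_congr rfl fun i _ => ?_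
    rw [abs_of_pos (hx i), show a + 1 - 1 = a - 1 + 1 by ring, Real.rpow_add_one (hx i).ne']
    ring
  rw [this]
  ring

theorem laguerreSelberg_add_one (n : ℕ) {a : ℝ} (ha : 0 < a) :
    laguerreSelberg n (a + 1) =
      (∏ r ∈ Finset.range n, (a + (r : ℝ) / 2)) * laguerreSelberg n a := by
  obtain _ | n := n
  · simp [laguerreSelberg, laguerreWeight]
  rw [← integral_prod_abs_mul_absVandermonde]
  have h := integral_prod_mul_absVandermonde ha (Finset.univ : Finset (Fin (n + 1)))
  rw [Finset.card_univ, Fintype.card_fin, ← Finset.prod_range_reflect] at h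
  convert! h using 1
  · refine integral_congr_ae ?_
    filter_upwards [ae_orthantMeasure_pos (n + 1)] with x hx
    simp only [abs_of_pos (hx _), mul_assoc]
  · congr 1
    refine Finset.prod_congr rfl fun r hr => ?_
    have : r ≤ n := Nat.lt_succ_iff.1 (Finset.mem_range.1 hr)
    rw [Nat.add_sub_cancel, Nat.cast_sub this]
    ring

theorem laguerreSelberg_succ_one (n : ℕ) :
    laguerreSelberg (n + 1) 1 = laguerreSelberg n 2 := by
  have hI := integrable_prod_mul_absVandermonde one_pos (∅ : Finset (Fin (n + 1)))
  have hQ : ∀ i ∈ Finset.univ, Integrable _ _ := fun (i : Fin n) _ =>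
    integrable_prod_mul_absVandermonde_div one_pos (∅ : Finset (Fin (n + 1))) 0
      ((0 : Fin (n + 1)).succAbove i)
  have hsum := hI.neg.add (integrable_finsetSum Finset.univ hQ)
  simp only [Finset.prod_empty, one_mul] at hI hQ hsum
  have heq : ∀ x : Fin (n + 1) → ℝ,
      ((0 : ℝ) * x 0 ^ ((0 : ℝ) - 1) - x 0 ^ (0 : ℝ) +
        ∑ i, x 0 ^ (0 : ℝ) / (x 0 - x ((0 : Fin (n + 1)).succAbove i))) *
      Real.exp (-x 0) * (∏ i, |x 0 - x ((0 : Fin (n + 1)).succAbove i)|) *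
        (absVandermonde (Fin.removeNth 0 x) * laguerreWeight 1 (Fin.removeNth 0 x)) =
      -(absVandermonde x * laguerreWeight 1 x) +
      ∑ i : Fin n, absVandermonde x / (x 0 - x ((0 : Fin (n + 1)).succAbove i)) *
        laguerreWeight 1 x := by
    intro x
    simp only [Real.rpow_zero, div_eq_mul_inv, ← Finset.mul_sum, ← Finset.sum_mul]
    rw [laguerreWeight_eq_mul_removeNth 1 0 x, absVandermonde_eq_prod_removeNth 0 x, sub_self,
      Real.rpow_zero]
    ring
  have hibp := integral_orthant_deriv (0 : Fin (n + 1)) le_rfl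
    (fun y => absVandermonde y * laguerreWeight 1 y)
    (hsum.congr (Filter.Eventually.of_forall fun x => (heq x).symm))
  have hzero : ∀ i : Fin n, ∫ x, absVandermonde x / (x 0 - x ((0 : Fin (n + 1)).succAbove i)) *
      laguerreWeight 1 x ∂orthantMeasure (n + 1) = 0 := fun i => by
    simpa using integral_prod_mul_absVandermonde_div_eq_zero 1 (∅ : Finset (Fin (n + 1)))
      (k := 0) (j := (0 : Fin (n + 1)).succAbove i) (by simp)
  rw [integral_congr_ae (Filter.Eventually.of_forall heq), Real.rpow_zero, one_mul,
    integral_prod_abs_mul_absVandermonde] at hibp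
  replace hibp := (integral_add hI.neg (integrable_finsetSum Finset.univ hQ)).symm.trans hibp
  rw [integral_neg', integral_finsetSum _ hQ] at hibp
  simp only [hzero, Finset.sum_const_zero, add_zero] at hibp
  rw [laguerreSelberg, neg_injective hibp]
  norm_num

/-! ### From exponent `1` to exponent `1 / 2` -/

lemma laguerreSelberg_nonneg (n : ℕ) (a : ℝ) : 0 ≤ laguerreSelberg n a := by
  refine integral_nonneg_of_ae ?_
  filter_upwards [ae_orthantMeasure_pos n] with x hx
  exact mul_nonneg (absVandermonde_nonneg x) (Finset.prod_nonneg fun i _ =>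
    mul_nonneg (Real.rpow_nonneg (hx i).le _) (Real.exp_pos _).le)

lemma integrable_absVandermonde_mul {n : ℕ} {a : ℝ} (ha : 0 < a) :
    Integrable (fun x => absVandermonde x * laguerreWeight a x) (orthantMeasure n) := by
  simpa using integrable_prod_mul_absVandermonde ha (∅ : Finset (Fin n))

lemma two_mul_laguerreWeight_add_half_le {n : ℕ} (a : ℝ) {x : Fin n → ℝ} (hx : ∀ i, 0 < x i)
    {t : ℝ} (ht : 0 < t) :
    2 * laguerreWeight (a + 1 / 2) x ≤ t * laguerreWeight a x + laguerreWeight (a + 1) x / t := by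
  have hw : 0 ≤ laguerreWeight a x := Finset.prod_nonneg fun i _ =>
    mul_nonneg (Real.rpow_nonneg (hx i).le _) (Real.exp_pos _).le
  have h (s : ℝ) : laguerreWeight (a + s) x = (∏ i, x i ^ s) * laguerreWeight a x := by
    rw [laguerreWeight, laguerreWeight, ← Finset.prod_mul_distrib]
    refine Finset.prod_congr rfl fun i _ => ?_
    rw [show a + s - 1 = s + (a - 1) by ring, Real.rpow_add (hx i), mul_assoc]
  have hsq : ∏ i, x i ^ (1 : ℝ) = (∏ i, x i ^ (1 / 2 : ℝ)) ^ 2 := by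
    rw [← Finset.prod_pow]
    refine Finset.prod_congr rfl fun i _ => ?_
    rw [← Real.rpow_natCast, ← Real.rpow_mul (hx i).le]
    norm_num
  rw [h, h 1, hsq]
  set p := ∏ i, x i ^ (1 / 2 : ℝ)
  have : t * laguerreWeight a x + p ^ 2 * laguerreWeight a x / t -
      2 * (p * laguerreWeight a x) = (t - p) ^ 2 / t * laguerreWeight a x := by
    field_simp
    ring
  have h2 : 0 ≤ (t - p) ^ 2 / t * laguerreWeight a x := by positivity
  linarith

lemma laguerreSelberg_add_half_le (n : ℕ) {a : ℝ} (ha : 0 < a) :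
    laguerreSelberg n (a + 1 / 2) ≤
      √(∏ r ∈ Finset.range n, (a + (r : ℝ) / 2)) * laguerreSelberg n a := by
  set g := ∏ r ∈ Finset.range n, (a + (r : ℝ) / 2) with hg
  have hgpos : 0 < g := Finset.prod_pos fun r _ => by positivity
  have ht : 0 < √g := Real.sqrt_pos.2 hgpos
  have hle : 2 * laguerreSelberg n (a + 1 / 2) ≤
      √g * laguerreSelberg n a + laguerreSelberg n (a + 1) / √g := by
    simp only [laguerreSelberg]
    rw [← integral_const_mul, ← integral_const_mul, ← integral_div, ← integral_add
      ((integrable_absVandermonde_mul ha).const_mul _)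
      ((integrable_absVandermonde_mul (by linarith)).div_const _)]
    refine integral_mono_ae ((integrable_absVandermonde_mul (by linarith)).const_mul _)
      (((integrable_absVandermonde_mul ha).const_mul _).add
      ((integrable_absVandermonde_mul (by linarith)).div_const _)) ?_
    filter_upwards [ae_orthantMeasure_pos n] with x hx
    have := mul_le_mul_of_nonneg_left (two_mul_laguerreWeight_add_half_le a hx ht)
      (absVandermonde_nonneg x)
    linarith [mul_div_assoc (absVandermonde x) (laguerreWeight (a + 1) x) √g]
  rw [laguerreSelberg_add_one n ha, ← hg] at hle
  have : g * laguerreSelberg n a / √g = √g * laguerreSelberg n a := by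
    rw [mul_div_right_comm, Real.div_sqrt]
  linarith

lemma Gamma_add_half_le {a : ℝ} (ha : 0 < a) :
    Real.Gamma (a + 1 / 2) ≤ √a * Real.Gamma a := by
  have h := Real.Gamma_mul_add_mul_le_rpow_Gamma_mul_rpow_Gamma ha (by linarith : 0 < a + 1)
    one_half_pos one_half_pos (by norm_num)
  have hG := Real.Gamma_pos_of_pos ha
  rw [Real.Gamma_add_one ha.ne', ← Real.mul_rpow hG.le (by positivity), ← Real.sqrt_eq_rpow,
    show Real.Gamma a * (a * Real.Gamma a) = a * Real.Gamma a ^ 2 by ring,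
    Real.sqrt_mul ha.le, Real.sqrt_sq hG.le] at h
  convert! h using 2
  ring

/-- The product `∏ r < n, Γ (a + r / 2)`. -/
noncomputable def gammaProd (n : ℕ) (a : ℝ) : ℝ :=
  ∏ r ∈ Finset.range n, Real.Gamma (a + (r : ℝ) / 2)

lemma gammaProd_pos (n : ℕ) {a : ℝ} (ha : 0 < a) : 0 < gammaProd n a :=
  Finset.prod_pos fun _ _ => Real.Gamma_pos_of_pos (by positivity)

lemma gammaProd_add_one (n : ℕ) {a : ℝ} (ha : 0 < a) :
    gammaProd n (a + 1) = (∏ r ∈ Finset.range n, (a + (r : ℝ) / 2)) * gammaProd n a := by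
  rw [gammaProd, gammaProd, ← Finset.prod_mul_distrib]
  refine Finset.prod_congr rfl fun r _ => ?_
  rw [add_right_comm, Real.Gamma_add_one (by positivity)]

lemma gammaProd_add_half_le (n : ℕ) {a : ℝ} (ha : 0 < a) :
    gammaProd n (a + 1 / 2) ≤ √(∏ r ∈ Finset.range n, (a + (r : ℝ) / 2)) * gammaProd n a := by
  rw [Real.sqrt_prod _ fun r _ => by positivity, gammaProd, gammaProd, ← Finset.prod_mul_distrib]
  refine Finset.prod_le_prod (fun r _ => (Real.Gamma_pos_of_pos (by positivity)).le) fun r _ => ?_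
  rw [add_right_comm]
  exact Gamma_add_half_le (by positivity)

lemma prod_add_half_shift (n : ℕ) {a : ℝ} (ha : 0 < a) :
    ∏ r ∈ Finset.range n, (a + 1 / 2 + (r : ℝ) / 2) =
      (a + n / 2) / a * ∏ r ∈ Finset.range n, (a + (r : ℝ) / 2) := by
  induction n with
  | zero => simp [ha.ne']
  | succ n ih =>
    rw [Finset.prod_range_succ, ih, Finset.prod_range_succ]
    push_cast
    field_simp
    ring

/-- The quotient of the Selberg integral by its expected dependence on the exponent. -/
noncomputable def selbergRatio (n : ℕ) (a : ℝ) : ℝ := laguerreSelberg n a / gammaProd n a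

lemma selbergRatio_add_one (n : ℕ) {a : ℝ} (ha : 0 < a) :
    selbergRatio n (a + 1) = selbergRatio n a := by
  have : 0 < ∏ r ∈ Finset.range n, (a + (r : ℝ) / 2) := Finset.prod_pos fun r _ => by positivity
  rw [selbergRatio, selbergRatio, laguerreSelberg_add_one n ha, gammaProd_add_one n ha,
    mul_div_mul_left _ _ this.ne']

lemma selbergRatio_add_natCast (n N : ℕ) {a : ℝ} (ha : 0 < a) :
    selbergRatio n (a + N) = selbergRatio n a := by
  induction N with
  | zero => simp
  | succ N ih =>
    rw [Nat.cast_succ, ← add_assoc, selbergRatio_add_one n (by positivity), ih]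

lemma selbergRatio_add_half_le_mul (n : ℕ) {a : ℝ} (ha : 0 < a) :
    selbergRatio n (a + 1 / 2) ≤ √((a + n / 2) / a) * selbergRatio n a := by
  set g := ∏ r ∈ Finset.range n, (a + (r : ℝ) / 2) with hg
  have hgpos : 0 < g := Finset.prod_pos fun r _ => by positivity
  have hL := laguerreSelberg_add_half_le n ha
  have hG := gammaProd_add_half_le n (a := a + 1 / 2) (by positivity)
  rw [add_assoc, add_halves, gammaProd_add_one n ha, prod_add_half_shift n ha,
    Real.sqrt_mul (by positivity), ← hg] at hG
  rw [← hg] at hL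
  have hGa := gammaProd_pos n ha
  have hGh := gammaProd_pos n (a := a + 1 / 2) (by positivity)
  have hL0 := laguerreSelberg_nonneg n a
  have hs : 0 < √g := Real.sqrt_pos.2 hgpos
  have hG' : √g * gammaProd n a ≤ √((a + n / 2) / a) * gammaProd n (a + 1 / 2) := by
    refine le_of_mul_le_mul_left ?_ hs
    calc √g * (√g * gammaProd n a) = g * gammaProd n a := by
          rw [← mul_assoc, Real.mul_self_sqrt hgpos.le]
      _ ≤ _ := hG.trans_eq (by ring)
  rw [selbergRatio, selbergRatio, ← mul_div_assoc, div_le_div_iff₀ hGh hGa]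
  calc laguerreSelberg n (a + 1 / 2) * gammaProd n a
      ≤ √g * laguerreSelberg n a * gammaProd n a := by gcongr
    _ = laguerreSelberg n a * (√g * gammaProd n a) := by ring
    _ ≤ laguerreSelberg n a * (√((a + n / 2) / a) * gammaProd n (a + 1 / 2)) := by gcongr
    _ = _ := by ring

lemma selbergRatio_add_half_le (n : ℕ) {a : ℝ} (ha : 0 < a) :
    selbergRatio n (a + 1 / 2) ≤ selbergRatio n a := by
  have hlim : Filter.Tendsto (fun N : ℕ => √((a + N + n / 2) / (a + N)) * selbergRatio n a)
      Filter.atTop (nhds (√(1 + 0) * selbergRatio n a)) := by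
    have h1 : Filter.Tendsto (fun N : ℕ => a + (N : ℝ)) Filter.atTop Filter.atTop :=
      Filter.tendsto_atTop_add_const_left _ _ tendsto_natCast_atTop_atTop
    have h2 := ((h1.const_div_atTop ((n : ℝ) / 2)).const_add 1).sqrt.mul_const (selbergRatio n a)
    refine h2.congr fun N => ?_
    have : a + (N : ℝ) ≠ 0 := by positivity
    congr 2
    field_simp
  rw [add_zero, Real.sqrt_one, one_mul] at hlim
  refine ge_of_tendsto' hlim fun N => ?_
  have h := selbergRatio_add_half_le_mul n (a := a + N) (by positivity)
  rwa [add_right_comm, selbergRatio_add_natCast n N (by positivity),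
    selbergRatio_add_natCast n N ha] at h

lemma selbergRatio_half (n : ℕ) : selbergRatio n (1 / 2) = selbergRatio n 1 := by
  apply le_antisymm
  · have h := selbergRatio_add_half_le n one_pos
    rwa [add_comm, selbergRatio_add_one n one_half_pos] at h
  · simpa only [add_halves] using selbergRatio_add_half_le n one_half_pos

lemma gammaProd_two_mul (n : ℕ) :
    gammaProd n 2 * Real.Gamma (3 / 2) = gammaProd (n + 1) 1 * Real.Gamma (1 + (n + 1) / 2) := by
  rw [gammaProd, gammaProd, Finset.prod_range_succ', Nat.cast_zero, zero_div, add_zero,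
    Real.Gamma_one, mul_one]
  have h := Finset.prod_range_succ (fun r : ℕ => Real.Gamma (1 + (r + 1 : ℝ) / 2)) n
  rw [Finset.prod_range_succ'] at h
  push_cast at h ⊢
  rw [← h]
  congr 1
  · refine Finset.prod_congr rfl fun r _ => ?_
    congr 1
    ring
  · norm_num

lemma selbergRatio_one (n : ℕ) :
    selbergRatio n 1 =
      ∏ r ∈ Finset.range n, (Real.Gamma (1 + (r + 1 : ℝ) / 2) / Real.Gamma (3 / 2)) := by
  induction n with
  | zero =>
    simp [selbergRatio, laguerreSelberg, gammaProd, laguerreWeight, absVandermonde,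
      orthantMeasure, measureReal_def]
  | succ n ih =>
    rw [Finset.prod_range_succ, ← ih, ← selbergRatio_add_one n one_pos, one_add_one_eq_two,
      selbergRatio, selbergRatio, laguerreSelberg_succ_one]
    have h1 := gammaProd_pos n (a := 2) two_pos
    have h2 := gammaProd_pos (n + 1) (a := 1) one_pos
    have h3 : 0 < Real.Gamma (3 / 2) := Real.Gamma_pos_of_pos (by norm_num)
    rw [div_mul_div_comm, gammaProd_two_mul, mul_div_mul_right]
    exact (Real.Gamma_pos_of_pos (by positivity)).ne'

theorem laguerreSelberg_half (n : ℕ) :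
    laguerreSelberg n (1 / 2) = ∏ r ∈ Finset.range n,
      (Real.Gamma (1 + (r + 1 : ℝ) / 2) * Real.Gamma ((r + 1 : ℝ) / 2) / (√π / 2)) := by
  have hG := gammaProd_pos n one_half_pos
  have h : laguerreSelberg n (1 / 2) = selbergRatio n 1 * gammaProd n (1 / 2) := by
    rw [← selbergRatio_half, selbergRatio, div_mul_cancel₀ _ hG.ne']
  have h3 : Real.Gamma (3 / 2) = √π / 2 := by
    rw [show (3 / 2 : ℝ) = 1 / 2 + 1 by norm_num, Real.Gamma_add_one (by norm_num),
      Real.Gamma_one_half_eq]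
    ring
  rw [h, selbergRatio_one, gammaProd, ← Finset.prod_mul_distrib, h3]
  refine Finset.prod_congr rfl fun r _ => ?_
  rw [show (1 / 2 : ℝ) + (r : ℝ) / 2 = (r + 1) / 2 by ring]
  ring

/-! ### The substitution `x = ω ^ 2 / 2` -/

lemma lintegral_pi_fin_prod {n : ℕ} {α : Type*} [MeasurableSpace α] (μ : Fin n → Measure α)
    [∀ i, SigmaFinite (μ i)] (f : Fin n → α → ℝ≥0∞) (hf : ∀ i, Measurable (f i)) :
    ∫⁻ x, ∏ i, f i (x i) ∂Measure.pi μ = ∏ i, ∫⁻ t, f i t ∂μ i := by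
  induction n with
  | zero => simp
  | succ n ih =>
    have hmp := measurePreserving_piFinSuccAbove μ 0
    have h := hmp.lintegral_comp_emb (MeasurableEquiv.measurableEmbedding _)
      fun p : α × (Fin n → α) => f 0 p.1 * ∏ i, f i.succ (p.2 i)
    simp only [Fin.succAbove_zero] at h
    rw [lintegral_prod_mul (hf 0).aemeasurable
      (by fun_prop : Measurable fun y : Fin n → α => ∏ i, f i.succ (y i)).aemeasurable,
      ih (fun i => μ i.succ) _ fun i => hf i.succ,
      ← Fin.prod_univ_succ fun i => ∫⁻ t, f i t ∂μ i] at h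
    rw [← h]
    refine lintegral_congr fun x => ?_
    rw [Fin.prod_univ_succ]
    rfl

lemma pi_withDensity_fin {n : ℕ} {α : Type*} [MeasurableSpace α] (μ : Measure α)
    [SigmaFinite μ] {f : α → ℝ≥0∞} (hf : Measurable f) [SigmaFinite (μ.withDensity f)] :
    Measure.pi (fun _ : Fin n => μ.withDensity f) =
      (Measure.pi fun _ : Fin n => μ).withDensity fun x => ∏ i, f (x i) := by
  refine Measure.pi_eq fun s hs => ?_
  rw [withDensity_apply _ (MeasurableSet.univ_pi hs), Measure.restrict_pi_pi,
    lintegral_pi_fin_prod _ _ fun _ => hf]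
  exact Finset.prod_congr rfl fun i _ => (withDensity_apply _ (hs i)).symm

lemma map_sq_div_two_volume :
    Measure.map (fun w : ℝ => w ^ 2 / 2) volume =
      (volume.restrict (Set.Ioi (0 : ℝ))).withDensity
        fun x => ENNReal.ofReal (√2 * x ^ (-(1 / 2) : ℝ)) := by
  ext s hs
  have hφ : Measurable fun w : ℝ => w ^ 2 / 2 := by fun_prop
  rw [Measure.map_apply hφ hs, withDensity_apply _ hs, Measure.restrict_restrict hs]
  set P := (fun w : ℝ => w ^ 2 / 2) ⁻¹' s
  set Q := P ∩ Set.Ioi 0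
  have hQm : MeasurableSet Q := (hφ hs).inter measurableSet_Ioi
  have hPQ : P \ {0} = Q ∪ -Q := by
    ext w
    have : w ∈ P ↔ -w ∈ P := by simp [P]
    simp only [Set.mem_sdiff, Set.mem_singleton_iff, Set.mem_union, Set.mem_neg, Q, Set.mem_inter_iff,
      Set.mem_Ioi, ← this, neg_pos, ← and_or_left]
    exact and_congr_right fun _ => ne_iff_lt_or_gt.trans or_comm
  have hdisj : Disjoint Q (-Q) := Set.disjoint_left.2 fun w h1 h2 => by
    have a1 : 0 < w := h1.2
    have a2 : 0 < -w := h2.2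
    linarith
  have hP : volume P = 2 * volume Q := by
    rw [← measure_sdiff_null (measure_singleton (0 : ℝ)), hPQ, measure_union hdisj hQm.neg,
      Measure.measure_neg, two_mul]
  have himg : Q = (fun x : ℝ => √(2 * x)) '' (s ∩ Set.Ioi 0) := by
    ext w
    constructor
    · rintro ⟨h1, h2⟩
      have h2 : 0 < w := h2
      refine ⟨w ^ 2 / 2, ⟨h1, by simp only [Set.mem_Ioi]; positivity⟩, ?_⟩
      simp only
      rw [mul_div_cancel₀ _ two_ne_zero, Real.sqrt_sq h2.le]
    · rintro ⟨x, ⟨h1, h2⟩, rfl⟩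
      have h2 : 0 < x := h2
      refine ⟨?_, Real.sqrt_pos.2 (by positivity)⟩
      have : √(2 * x) ^ 2 / 2 ∈ s := by
        rw [Real.sq_sqrt (by positivity), mul_div_cancel_left₀ _ two_ne_zero]
        exact h1
      exact this
  have hder : ∀ x ∈ s ∩ Set.Ioi (0 : ℝ),
      HasDerivWithinAt (fun x : ℝ => √(2 * x)) (1 / √(2 * x)) (s ∩ Set.Ioi 0) x := by
    rintro x ⟨-, hx⟩
    have hx : 0 < x := hx
    have h := ((hasDerivAt_id x).const_mul 2).sqrt (by simpa using hx.ne')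
    convert! h.hasDerivWithinAt using 1
    simp only [id, mul_one]
    rw [div_mul_cancel_left₀ two_ne_zero, one_div]
  have hinj : Set.InjOn (fun x : ℝ => √(2 * x)) (s ∩ Set.Ioi 0) := by
    rintro x ⟨-, hx⟩ y ⟨-, hy⟩ hxy
    have hx : 0 < x := hx
    have hy : 0 < y := hy
    have := (Real.sqrt_inj (by positivity) (by positivity)).1 hxy
    linarith
  have hcv := lintegral_image_eq_lintegral_abs_deriv_mul (hs.inter measurableSet_Ioi) hder hinj 1
  rw [← himg] at hcv
  simp only [Pi.one_apply, mul_one, setLIntegral_one] at hcv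
  rw [hP, hcv, ← lintegral_const_mul _ (by fun_prop)]
  refine setLIntegral_congr_fun (hs.inter measurableSet_Ioi) fun x hx => ?_
  have hx : 0 < x := hx.2
  rw [← ENNReal.ofReal_ofNat 2, ← ENNReal.ofReal_mul two_pos.le, abs_of_pos (by positivity),
    Real.rpow_neg hx.le, ← Real.sqrt_eq_rpow, Real.sqrt_mul two_pos.le]
  congr 1
  have := Real.mul_self_sqrt (two_pos : (0 : ℝ) < 2).le
  have : √x ≠ 0 := by positivity
  field_simp
  linarith

lemma lintegral_sq_div_two {n : ℕ} {F : (Fin n → ℝ) → ℝ≥0∞} (hF : Measurable F) :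
    ∫⁻ w : Fin n → ℝ, F (fun i => w i ^ 2 / 2) =
      ∫⁻ x, (∏ i, ENNReal.ofReal (√2 * x i ^ (-(1 / 2) : ℝ))) * F x ∂orthantMeasure n := by
  have hsf : SigmaFinite (Measure.map (fun w : ℝ => w ^ 2 / 2) volume) := by
    rw [map_sq_div_two_volume]; infer_instance
  have hmap := Measure.pi_map_pi (ι := Fin n) (μ := fun _ => (volume : Measure ℝ))
    (f := fun _ w => w ^ 2 / 2) (hμ := fun _ => hsf)
    fun _ => (by fun_prop : Measurable fun w : ℝ => w ^ 2 / 2).aemeasurable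
  simp only [map_sq_div_two_volume] at hmap
  rw [pi_withDensity_fin _ (by fun_prop)] at hmap
  rw [← lintegral_map hF (by fun_prop : Measurable fun (w : Fin n → ℝ) i => w i ^ 2 / 2),
    volume_pi, hmap, lintegral_withDensity_eq_lintegral_mul _ (by fun_prop) hF]
  rfl

lemma prod_prod_Ioi_two_mul_sqrt_two_pow (m : ℕ) :
    (∏ i : Fin m, ∏ _j ∈ Finset.Ioi i, (2 : ℝ)) * √2 ^ m = √2 ^ (m ^ 2) := by
  induction m with
  | zero => simp
  | succ m ih =>
    rw [Fin.prod_univ_succ]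
    simp only [Fin.prod_Ioi_zero, Fin.prod_Ioi_succ]
    have h2 : (2 : ℝ) ^ m = √2 ^ (2 * m) := by rw [pow_mul, Real.sq_sqrt two_pos.le]
    rw [Finset.prod_const, Finset.card_univ, Fintype.card_fin, pow_succ √2 m,
      show ∀ a b c d : ℝ, a * b * (c * d) = a * d * (b * c) by intros; ring, ih, h2]
    ring

lemma lintegral_gaussian_eq_laguerreSelberg (m : ℕ) :
    (∫⁻ ω : Fin m → ℝ,
        ENNReal.ofReal
          ((∏ i : Fin m, ∏ j ∈ Finset.Ioi i, |ω i ^ 2 - ω j ^ 2|) *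
            Real.exp (-(1 / 2) * ∑ i, ω i ^ 2)))
      = ENNReal.ofReal (√2 ^ (m ^ 2) * laguerreSelberg m (1 / 2)) := by
  set C : ℝ := ∏ i : Fin m, ∏ _j ∈ Finset.Ioi i, (2 : ℝ) with hC
  have hV := measurable_absVandermonde (n := m)
  have h := lintegral_sq_div_two (n := m)
    (F := fun x => ENNReal.ofReal (C * absVandermonde x * Real.exp (-∑ i, x i))) (by fun_prop)
  have hL : ∀ ω : Fin m → ℝ,
      (∏ i : Fin m, ∏ j ∈ Finset.Ioi i, |ω i ^ 2 - ω j ^ 2|) *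
        Real.exp (-(1 / 2) * ∑ i, ω i ^ 2) =
      C * absVandermonde (fun i => ω i ^ 2 / 2) * Real.exp (-∑ i, ω i ^ 2 / 2) := by
    intro ω
    rw [hC, absVandermonde, Matrix.det_vandermonde]
    simp only [Finset.abs_prod, ← Finset.prod_mul_distrib]
    congr 1
    · refine Finset.prod_congr rfl fun i _ => Finset.prod_congr rfl fun j _ => ?_
      rw [← sub_div, abs_div, abs_two, mul_div_cancel₀ _ two_ne_zero, abs_sub_comm]
    · rw [← Finset.sum_div]
      ring_nf
  simp only [hL]
  rw [h, laguerreSelberg, ← integral_const_mul, ofReal_integral_eq_lintegral_ofReal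
    ((integrable_absVandermonde_mul one_half_pos).const_mul _)]
  · refine lintegral_congr_ae ?_
    filter_upwards [ae_orthantMeasure_pos m] with x hx
    rw [← ENNReal.ofReal_prod_of_nonneg fun i _ => by have := (hx i).le; positivity,
      ← ENNReal.ofReal_mul (Finset.prod_nonneg fun i _ => by have := (hx i).le; positivity),
      ← prod_prod_Ioi_two_mul_sqrt_two_pow, ← hC, laguerreWeight, ← Finset.sum_neg_distrib,
      Real.exp_sum, Finset.prod_mul_distrib, Finset.prod_mul_distrib, Finset.prod_const,
      Finset.card_univ, Fintype.card_fin, show (1 / 2 : ℝ) - 1 = -(1 / 2) by norm_num]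
    congr 1
    ring
  · filter_upwards [ae_orthantMeasure_pos m] with x hx
    exact mul_nonneg (by positivity) (mul_nonneg (absVandermonde_nonneg x)
      (Finset.prod_nonneg fun i _ => mul_nonneg (Real.rpow_nonneg (hx i).le _)
        (Real.exp_pos _).le))

/-- A Selberg-type integral:
`∫_{ℝ^m} ∏_{i<j} |ωᵢ² − ωⱼ²| e^{-½∑ωᵢ²} dω
  = (2π)^(m²/2) · 2^m · ∏_{j=1}^m Γ(1+j/2)Γ(j/2) · π^(−m(m+1)/2)`. -/
theorem selberg_vandermonde_gaussian (m : ℕ) (hm : 1 ≤ m) :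
    (∫⁻ ω : Fin m → ℝ,
        ENNReal.ofReal
          ((∏ i : Fin m, ∏ j ∈ Finset.Ioi i, |ω i ^ 2 - ω j ^ 2|) *
            Real.exp (-(1 / 2) * ∑ i, ω i ^ 2)))
      = ENNReal.ofReal ((2 * Real.pi) ^ ((m ^ 2 : ℝ) / 2) * 2 ^ m *
          (∏ j ∈ Finset.range m,
            Real.Gamma (1 + ((j + 1) : ℝ) / 2) * Real.Gamma (((j + 1) : ℝ) / 2)) *
          Real.pi ^ (-(m * (m + 1) : ℝ) / 2)) := by
  rw [lintegral_gaussian_eq_laguerreSelberg, laguerreSelberg_half, Finset.prod_div_distrib,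
    Finset.prod_const, Finset.card_range]
  congr 1
  have hπ := Real.pi_pos
  have h2 : (2 : ℝ) ^ ((m ^ 2 : ℝ) / 2) = √2 ^ (m ^ 2) := by
    rw [Real.sqrt_eq_rpow, ← Real.rpow_natCast _ (m ^ 2), ← Real.rpow_mul two_pos.le]
    push_cast
    ring_nf
  have h3 : π ^ ((m ^ 2 : ℝ) / 2) * π ^ (-(m * (m + 1) : ℝ) / 2) = (√π ^ m)⁻¹ := by
    rw [← Real.rpow_add hπ, Real.sqrt_eq_rpow, ← Real.rpow_natCast _ m, ← Real.rpow_mul hπ.le,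
      ← Real.rpow_neg hπ.le]
    ring_nf
  rw [Real.mul_rpow two_pos.le hπ.le, h2, div_pow]
  set G := ∏ j ∈ Finset.range m,
    Real.Gamma (1 + ((j + 1) : ℝ) / 2) * Real.Gamma (((j + 1) : ℝ) / 2)
  calc √2 ^ m ^ 2 * (G / (√π ^ m / 2 ^ m)) = √2 ^ m ^ 2 * 2 ^ m * G * (√π ^ m)⁻¹ := by
        rw [div_div_eq_mul_div]
        ring
    _ = _ := by
        rw [← h3]
        ring
end

section
/- Let m ≥ 1 be an integer and let f : ℝ → ℝ be a measurable nonnegative function such that the measure on real m×(m+1) matrices with density A ↦ f(tr(A Aᵀ)) with respect to Lebesgue measure is a probability measure. Write A = (B, x), where B is the m×m matrix formed by the first m columns of A and x ∈ ℝ^m is the last column. Then the pushforward, under the (almost everywhere defined) map A ↦ B⁻¹x, of the probability measure with density A ↦ f(tr(A Aᵀ)) is the measure on ℝ^m with density z ↦ (Γ((m+1)/2)/π^((m+1)/2)) · (1 + zᵀz)^(−(m+1)/2), i.e., the m-dimensional standard Cauchy distribution, independently of f. -/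
open MeasureTheory Matrix
open scoped ENNReal Real

section LebesgueMatrix

variable {ι : Type*} [Fintype ι]

theorem lintegral_ofReal_rpow_mul_exp_neg_mul_Ioi {a r : ℝ} (ha : 0 < a) (hr : 0 < r) :
    ∫⁻ t in Set.Ioi (0 : ℝ), ENNReal.ofReal (t ^ (a - 1) * Real.exp (-(r * t))) =
      ENNReal.ofReal (r ^ (-a) * Real.Gamma a) := by
  have hI := Real.integral_rpow_mul_exp_neg_mul_Ioi ha hr
  have hΓ := Real.Gamma_pos_of_pos ha
  rw [one_div, Real.inv_rpow hr.le, ← Real.rpow_neg hr.le] at hI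
  have hint : IntegrableOn (fun t : ℝ => t ^ (a - 1) * Real.exp (-(r * t))) (Set.Ioi 0) :=
    not_imp_comm.1 integral_undef (by rw [hI]; positivity)
  rw [← hI, ofReal_integral_eq_lintegral_ofReal hint]
  filter_upwards [self_mem_ae_restrict measurableSet_Ioi] with t ht
  have : 0 < t := ht
  simp only [Pi.zero_apply]
  positivity

theorem lintegral_ofReal_exp_neg_mul_sum_sq {b : ℝ} (hb : 0 < b) :
    ∫⁻ z : ι → ℝ, ENNReal.ofReal (Real.exp (-(b * ∑ i, z i ^ 2))) =
      ENNReal.ofReal ((π / b) ^ ((Fintype.card ι : ℝ) / 2)) := by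
  have hI : ∫ z : ι → ℝ, Real.exp (-(b * ∑ i, z i ^ 2)) =
      (π / b) ^ ((Fintype.card ι : ℝ) / 2) := by
    have h := integral_fintype_prod_volume_eq_pow (ι := ι) fun x : ℝ => Real.exp (-b * x ^ 2)
    rw [integral_gaussian, Real.sqrt_eq_rpow, ← Real.rpow_natCast, ← Real.rpow_mul (by positivity),
      one_div_mul_eq_div] at h
    rw [← h]
    congr with z
    rw [← Real.exp_sum, ← Finset.mul_sum, neg_mul]
  have hint : Integrable (fun z : ι → ℝ => Real.exp (-(b * ∑ i, z i ^ 2))) :=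
    not_imp_comm.1 integral_undef (by rw [hI]; positivity)
  rw [← hI, ofReal_integral_eq_lintegral_ofReal hint (.of_forall fun z => by positivity)]

theorem lintegral_ofReal_one_add_sum_sq_rpow :
    ∫⁻ z : ι → ℝ, ENNReal.ofReal ((1 + ∑ i, z i ^ 2) ^ (-((Fintype.card ι : ℝ) + 1) / 2)) =
      ENNReal.ofReal (π ^ ((Fintype.card ι + 1 : ℝ) / 2) /
        Real.Gamma ((Fintype.card ι + 1 : ℝ) / 2)) := by
  set n : ℝ := (Fintype.card ι : ℝ) with hn
  set a : ℝ := (n + 1) / 2 with ha_def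
  have ha : 0 < a := by positivity
  have hΓ := Real.Gamma_pos_of_pos ha
  have hz (z : ι → ℝ) : 0 < 1 + ∑ i, z i ^ 2 := by positivity
  have key : (∫⁻ z : ι → ℝ, ENNReal.ofReal ((1 + ∑ i, z i ^ 2) ^ (-(n + 1) / 2))) *
      ENNReal.ofReal (Real.Gamma a) = ENNReal.ofReal (π ^ a) := by
    rw [← lintegral_mul_const _ (by fun_prop)]
    calc
      _ = ∫⁻ z : ι → ℝ, ∫⁻ t in Set.Ioi (0 : ℝ),
            ENNReal.ofReal (t ^ (a - 1) * Real.exp (-((1 + ∑ i, z i ^ 2) * t))) := by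
        refine lintegral_congr fun z => ?_
        rw [lintegral_ofReal_rpow_mul_exp_neg_mul_Ioi ha (hz z),
          ENNReal.ofReal_mul (by positivity [hz z]), neg_div]
      _ = ∫⁻ t in Set.Ioi (0 : ℝ), ∫⁻ z : ι → ℝ,
            ENNReal.ofReal (t ^ (a - 1) * Real.exp (-((1 + ∑ i, z i ^ 2) * t))) :=
        lintegral_lintegral_swap (by fun_prop)
      _ = ∫⁻ t in Set.Ioi (0 : ℝ),
            ENNReal.ofReal (π ^ (n / 2)) *
              ENNReal.ofReal (t ^ ((1 / 2 : ℝ) - 1) * Real.exp (-(1 * t))) := by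
        refine setLIntegral_congr_fun measurableSet_Ioi fun t (ht : 0 < t) => ?_
        have h1 (z : ι → ℝ) :
            ENNReal.ofReal (t ^ (a - 1) * Real.exp (-((1 + ∑ i, z i ^ 2) * t))) =
              ENNReal.ofReal (t ^ (a - 1) * Real.exp (-(1 * t))) *
                ENNReal.ofReal (Real.exp (-(t * ∑ i, z i ^ 2))) := by
          rw [← ENNReal.ofReal_mul (by positivity), mul_assoc, ← Real.exp_add]
          ring_nf
        simp only [h1]
        rw [lintegral_const_mul _ (by fun_prop), lintegral_ofReal_exp_neg_mul_sum_sq ht,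
          ← ENNReal.ofReal_mul (by positivity), ← ENNReal.ofReal_mul (by positivity), ← hn,
          Real.div_rpow Real.pi_pos.le ht.le]
        have h2 : t ^ (a - 1) = t ^ ((1 / 2 : ℝ) - 1) * t ^ (n / 2) := by
          rw [← Real.rpow_add ht]
          congr 1
          rw [ha_def]
          ring
        rw [h2]
        congr 1
        have : t ^ (n / 2) ≠ 0 := by positivity
        field_simp
      _ = _ := by
        rw [lintegral_const_mul _ (by fun_prop),
          lintegral_ofReal_rpow_mul_exp_neg_mul_Ioi (by norm_num) one_pos,
          ← ENNReal.ofReal_mul (by positivity), Real.one_rpow, one_mul, Real.Gamma_one_half_eq,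
          Real.sqrt_eq_rpow, ← Real.rpow_add Real.pi_pos, ← add_div]
  rw [ENNReal.ofReal_div_of_pos hΓ, ← key,
    ENNReal.mul_div_cancel_right (by simpa using hΓ) ENNReal.ofReal_ne_top]

variable [DecidableEq ι]

theorem measurable_det_of : Measurable fun B : ι → ι → ℝ => (Matrix.of B).det := by
  simp only [Matrix.det_apply, Matrix.of_apply]
  fun_prop

theorem ae_det_of_ne_zero : ∀ᵐ B : ι → ι → ℝ, (Matrix.of B).det ≠ 0 := by
  let e : ι → ι → ℝ := (1 : Matrix ι ι ℝ)
  have hae (B : ι → ι → ℝ) : ∀ᵐ t : ℝ, (Matrix.of (B + t • e)).det ≠ 0 := by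
    have hfin : {t : ℝ | (Matrix.of (B + t • e)).det = 0}.Finite := by
      refine ((-(Matrix.of B)).charpoly.roots.toFinset.finite_toSet).subset fun t ht => ?_
      have h0 := (-(Matrix.of B)).charpoly_monic.ne_zero
      simp only [Finset.mem_coe, Multiset.mem_toFinset, Polynomial.mem_roots h0,
        Polynomial.IsRoot.def, Matrix.eval_charpoly]
      rw [← (show (Matrix.of (B + t • e)).det = 0 from ht)]
      congr 1
      ext i j
      change _ = B i j + t * (1 : Matrix ι ι ℝ) i j
      simp [Matrix.scalar_apply, Matrix.one_apply, Matrix.diagonal_apply, add_comm]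
    simpa [ae_iff] using hfin.measure_zero volume
  have hswap : ∀ᵐ t : ℝ, ∀ᵐ B : ι → ι → ℝ, (Matrix.of (B + t • e)).det ≠ 0 := by
    refine (Measure.ae_ae_comm
      (p := fun (B : ι → ι → ℝ) (t : ℝ) => (Matrix.of (B + t • e)).det ≠ 0) ?_).1
      (.of_forall hae)
    exact (measurableSet_eq_fun (measurable_det_of.comp (by fun_prop)) measurable_const).compl
  obtain ⟨t, ht⟩ := hswap.exists
  simpa using (measurePreserving_add_right (volume : Measure (ι → ι → ℝ))
    (-(t • e))).quasiMeasurePreserving.ae ht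

theorem lintegral_comp_mulVec_mul_abs_det {M : Matrix ι ι ℝ} (hM : M.det ≠ 0)
    {g : (ι → ℝ) → ℝ≥0∞} (hg : Measurable g) :
    ∫⁻ z, ENNReal.ofReal |M.det| * g (M *ᵥ z) = ∫⁻ x, g x := by
  have hmap := Real.map_matrix_volume_pi_eq_smul_volume_pi hM
  have hmeas : Measurable fun z : ι → ℝ => M *ᵥ z :=
    (Continuous.matrix_mulVec continuous_const continuous_id).measurable
  have h : ∫⁻ z, g (M *ᵥ z) = ENNReal.ofReal |M.det⁻¹| * ∫⁻ x, g x := by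
    rw [← smul_eq_mul, ← lintegral_smul_measure, ← hmap]
    exact (lintegral_map hg hmeas).symm
  rw [lintegral_const_mul (f := fun z => g (M *ᵥ z)) _ (hg.comp hmeas), h, ← mul_assoc,
    ← ENNReal.ofReal_mul (abs_nonneg _), ← abs_mul, mul_inv_cancel₀ hM]
  simp

theorem lintegral_comp_matrix_mul_mul_abs_det_pow {κ : Type*} [Fintype κ]
    {R : Matrix ι ι ℝ} (hR : R.det ≠ 0) {g : (κ → ι → ℝ) → ℝ≥0∞} (hg : Measurable g) :
    ENNReal.ofReal (|R.det| ^ Fintype.card κ) * ∫⁻ B : κ → ι → ℝ, g (Matrix.of B * R) =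
      ∫⁻ C, g C := by
  let L : (κ → ι → ℝ) →ₗ[ℝ] (κ → ι → ℝ) :=
    LinearMap.pi fun i => (Matrix.toLin' Rᵀ).comp (LinearMap.proj i)
  have hL (B : κ → ι → ℝ) : L B = Matrix.of B * R := by
    ext i j
    simp [L, Matrix.mul_apply, Matrix.mulVec, dotProduct, mul_comm]
  have hdet : LinearMap.det L = R.det ^ Fintype.card κ := by
    simp only [L]
    rw [LinearMap.det_pi]
    simp [LinearMap.det_toLin']
  have hne : LinearMap.det L ≠ 0 := by rw [hdet]; positivity
  have hmap := Measure.map_linearMap_addHaar_eq_smul_addHaar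
    (volume : Measure (κ → ι → ℝ)) hne
  have h : ∫⁻ B : κ → ι → ℝ, g (Matrix.of B * R) =
      ENNReal.ofReal |(LinearMap.det L)⁻¹| * ∫⁻ C, g C := by
    rw [← smul_eq_mul, ← lintegral_smul_measure, ← hmap,
      lintegral_map hg L.continuous_of_finiteDimensional.measurable]
    simp only [hL]
  rw [h, ← mul_assoc, ← ENNReal.ofReal_mul (by positivity), ← abs_pow, ← hdet, ← abs_mul,
    mul_inv_cancel₀ hne]
  simp

/-- A square root of `1 + z zᵀ`. -/
theorem exists_mul_transpose_eq_one_add_vecMulVec (z : ι → ℝ) :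
    ∃ R : Matrix ι ι ℝ, R.det = √(1 + ∑ i, z i ^ 2) ∧ R * Rᵀ = 1 + vecMulVec z z := by
  set t : ℝ := ∑ i, z i ^ 2 with ht
  have ht0 : 0 ≤ t := by positivity
  have hs := Real.sq_sqrt (show 0 ≤ 1 + t by positivity)
  have hs0 : 0 ≤ √(1 + t) := Real.sqrt_nonneg _
  set s := √(1 + t)
  have hdot : z ⬝ᵥ z = t := by simp [dotProduct, ht, sq]
  refine ⟨1 + (1 + s)⁻¹ • vecMulVec z z, ?_, ?_⟩
  · have h := det_one_add_replicateCol_mul_replicateRow (ι := Unit) ((1 + s)⁻¹ • z) z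
    rw [← vecMulVec_eq, smul_vecMulVec] at h
    rw [h, dotProduct_smul, hdot, smul_eq_mul]
    field_simp
    linarith
  · have hvv : vecMulVec z z * vecMulVec z z = t • vecMulVec z z := by
      rw [vecMulVec_mul_vecMulVec, hdot, vecMulVec_smul]
    have hT : (vecMulVec z z)ᵀ = vecMulVec z z := transpose_vecMulVec z z
    rw [transpose_add, transpose_smul, hT, transpose_one, add_mul, mul_add, mul_add, one_mul,
      mul_one, one_mul, smul_mul_assoc, mul_smul_comm, hvv, add_assoc, smul_smul, smul_smul,
      ← add_smul, ← add_smul]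
    congr 1
    convert one_smul ℝ _ using 2
    field_simp
    linarith

theorem measurable_inv_of_mulVec :
    Measurable fun p : (ι → ι → ℝ) × (ι → ℝ) => (Matrix.of p.1)⁻¹ *ᵥ p.2 := by
  have hadj (i j : ι) : Measurable fun B : ι → ι → ℝ => (Matrix.of B).adjugate i j := by
    have h : (fun B : ι → ι → ℝ => (Matrix.of B).adjugate i j) = fun B =>
        (Matrix.of (fun k l => if k = j then (Pi.single i 1 : ι → ℝ) l else B k l)).det := by
      ext B
      rw [Matrix.adjugate_apply]
      congr 1
      ext k l
      by_cases hk : k = j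
      · subst hk; simp
      · simp [hk]
    rw [h]
    refine measurable_det_of.comp
      (measurable_pi_lambda _ fun k => measurable_pi_lambda _ fun l => ?_)
    split_ifs <;> fun_prop
  have hdet : Measurable fun p : (ι → ι → ℝ) × (ι → ℝ) => (Matrix.of p.1).det :=
    measurable_det_of.comp measurable_fst
  have hadj' (i j : ι) : Measurable fun p : (ι → ι → ℝ) × (ι → ℝ) =>
      (Matrix.of p.1).adjugate i j := (hadj i j).comp measurable_fst
  refine measurable_pi_lambda _ fun i => ?_
  simp only [Matrix.inv_def, Ring.inverse_eq_inv', Matrix.mulVec, dotProduct, Matrix.smul_apply,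
    smul_eq_mul]
  fun_prop

theorem sum_sq_mul_eq_sum_sq_add_sum_sq_mulVec {κ : Type*} [Fintype κ] {R : Matrix ι ι ℝ}
    {z : ι → ℝ} (hR : R * Rᵀ = 1 + vecMulVec z z) (B : Matrix κ ι ℝ) :
    ∑ i, ∑ j, (B * R) i j ^ 2 = (∑ i, ∑ j, B i j ^ 2) + ∑ i, (B *ᵥ z) i ^ 2 := by
  have htr (n : Type _) [Fintype n] (C : Matrix κ n ℝ) :
      ∑ i, ∑ j, C i j ^ 2 = (C * Cᵀ).trace := by
    simp [Matrix.trace, Matrix.mul_apply, sq]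
  rw [htr, htr, transpose_mul, Matrix.mul_assoc, ← Matrix.mul_assoc R, hR, Matrix.add_mul,
    Matrix.one_mul, Matrix.mul_add, trace_add]
  congr 1
  rw [vecMulVec_mul, vecMul_transpose, mul_vecMulVec, trace_vecMulVec]
  simp [dotProduct, sq]

/-- Integrating a radial matrix density against the Jacobian of `z ↦ B z`. -/
theorem lintegral_abs_det_mul_comp_sum_sq_add {F : ℝ → ℝ≥0∞} (hF : Measurable F) (z : ι → ℝ) :
    ∫⁻ B : ι → ι → ℝ, ENNReal.ofReal |(Matrix.of B).det| *
        F ((∑ i, ∑ j, B i j ^ 2) + ∑ i, (Matrix.of B *ᵥ z) i ^ 2) =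
      ENNReal.ofReal ((1 + ∑ i, z i ^ 2) ^ (-((Fintype.card ι : ℝ) + 1) / 2)) *
        ∫⁻ C : ι → ι → ℝ, ENNReal.ofReal |(Matrix.of C).det| * F (∑ i, ∑ j, C i j ^ 2) := by
  obtain ⟨R, hdet, hR⟩ := exists_mul_transpose_eq_one_add_vecMulVec z
  have hz : 0 < 1 + ∑ i, z i ^ 2 := by positivity
  set r := 1 + ∑ i, z i ^ 2
  have hs : 0 < √r := Real.sqrt_pos.2 hz
  have hmeas := measurable_det_of (ι := ι)
  have hg : Measurable fun C : ι → ι → ℝ =>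
      ENNReal.ofReal |(Matrix.of C).det| * F (∑ i, ∑ j, C i j ^ 2) := by
    have : Measurable fun C : ι → ι → ℝ => F (∑ i, ∑ j, C i j ^ 2) := hF.comp (by fun_prop)
    fun_prop
  rw [← lintegral_comp_matrix_mul_mul_abs_det_pow (R := R) (by rw [hdet]; exact hs.ne') hg, hdet,
    abs_of_pos hs]
  have hcomp (B : ι → ι → ℝ) :
      ENNReal.ofReal |(Matrix.of (Matrix.of B * R)).det| *
          F (∑ i, ∑ j, (Matrix.of B * R) i j ^ 2) =
        ENNReal.ofReal √r * (ENNReal.ofReal |(Matrix.of B).det| *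
          F ((∑ i, ∑ j, B i j ^ 2) + ∑ i, (Matrix.of B *ᵥ z) i ^ 2)) := by
    rw [sum_sq_mul_eq_sum_sq_add_sum_sq_mulVec hR, ← mul_assoc, ← ENNReal.ofReal_mul hs.le]
    congr 2
    change |(Matrix.of B * R).det| = _
    rw [det_mul, hdet, abs_mul, abs_of_pos hs, mul_comm]
  simp only [hcomp]
  rw [lintegral_const_mul' _ _ ENNReal.ofReal_ne_top, ← mul_assoc, ← mul_assoc,
    ← ENNReal.ofReal_mul (by positivity), ← ENNReal.ofReal_mul (by positivity)]
  have h1 : r ^ (-((Fintype.card ι : ℝ) + 1) / 2) * √r ^ Fintype.card ι * √r = 1 := by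
    rw [mul_assoc, ← pow_succ, Real.sqrt_eq_rpow, ← Real.rpow_natCast, ← Real.rpow_mul hz.le,
      ← Real.rpow_add hz]
    convert Real.rpow_zero r using 2
    push_cast
    ring
  rw [h1]
  simp

/-- The law of `B⁻¹ x` under a radial density of `(B, x)` is a multiple of the Cauchy law. -/
theorem lintegral_indicator_inv_mulVec {F : ℝ → ℝ≥0∞} (hF : Measurable F) {s : Set (ι → ℝ)}
    (hs : MeasurableSet s) :
    ∫⁻ p : (ι → ι → ℝ) × (ι → ℝ), s.indicator 1 ((Matrix.of p.1)⁻¹ *ᵥ p.2) *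
        F ((∑ i, ∑ j, p.1 i j ^ 2) + ∑ i, p.2 i ^ 2) =
      (∫⁻ C : ι → ι → ℝ, ENNReal.ofReal |(Matrix.of C).det| * F (∑ i, ∑ j, C i j ^ 2)) *
        ∫⁻ z in s, ENNReal.ofReal ((1 + ∑ i, z i ^ 2) ^ (-((Fintype.card ι : ℝ) + 1) / 2)) := by
  have hone : Measurable (s.indicator (1 : (ι → ℝ) → ℝ≥0∞)) := measurable_one.indicator hs
  have hmeas : Measurable fun p : (ι → ι → ℝ) × (ι → ℝ) =>
      s.indicator (1 : (ι → ℝ) → ℝ≥0∞) ((Matrix.of p.1)⁻¹ *ᵥ p.2) *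
        F ((∑ i, ∑ j, p.1 i j ^ 2) + ∑ i, p.2 i ^ 2) :=
    (hone.comp measurable_inv_of_mulVec).mul (hF.comp (by fun_prop))
  have hdet : Measurable fun p : (ι → ι → ℝ) × (ι → ℝ) => (Matrix.of p.1).det :=
    measurable_det_of.comp measurable_fst
  have hjoint : Measurable fun p : (ι → ι → ℝ) × (ι → ℝ) =>
      ENNReal.ofReal |(Matrix.of p.1).det| * (s.indicator (1 : (ι → ℝ) → ℝ≥0∞) p.2 *
        F ((∑ i, ∑ j, p.1 i j ^ 2) + ∑ i, (Matrix.of p.1 *ᵥ p.2) i ^ 2)) := by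
    have : Measurable fun p : (ι → ι → ℝ) × (ι → ℝ) =>
        F ((∑ i, ∑ j, p.1 i j ^ 2) + ∑ i, (Matrix.of p.1 *ᵥ p.2) i ^ 2) := by
      simp only [Matrix.mulVec, dotProduct, Matrix.of_apply]
      exact hF.comp (by fun_prop)
    fun_prop
  calc
    _ = ∫⁻ B : ι → ι → ℝ, ∫⁻ x : ι → ℝ, s.indicator 1 ((Matrix.of B)⁻¹ *ᵥ x) *
          F ((∑ i, ∑ j, B i j ^ 2) + ∑ i, x i ^ 2) := by
      rw [Measure.volume_eq_prod, lintegral_prod _ hmeas.aemeasurable]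
    _ = ∫⁻ B : ι → ι → ℝ, ∫⁻ z : ι → ℝ, ENNReal.ofReal |(Matrix.of B).det| *
          (s.indicator 1 z *
            F ((∑ i, ∑ j, B i j ^ 2) + ∑ i, (Matrix.of B *ᵥ z) i ^ 2)) := by
      refine lintegral_congr_ae ?_
      filter_upwards [ae_det_of_ne_zero (ι := ι)] with B hB
      refine (lintegral_comp_mulVec_mul_abs_det hB
        (hmeas.comp (measurable_prodMk_left (x := B)))).symm.trans ?_
      refine lintegral_congr fun z => ?_
      simp only [Function.comp_apply]
      rw [mulVec_mulVec, nonsing_inv_mul _ (isUnit_iff_ne_zero.2 hB), one_mulVec]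
    _ = ∫⁻ z : ι → ℝ, ∫⁻ B : ι → ι → ℝ, ENNReal.ofReal |(Matrix.of B).det| *
          (s.indicator 1 z *
            F ((∑ i, ∑ j, B i j ^ 2) + ∑ i, (Matrix.of B *ᵥ z) i ^ 2)) :=
      lintegral_lintegral_swap hjoint.aemeasurable
    _ = ∫⁻ z : ι → ℝ, s.indicator (fun z =>
          (∫⁻ C : ι → ι → ℝ, ENNReal.ofReal |(Matrix.of C).det| * F (∑ i, ∑ j, C i j ^ 2)) *
            ENNReal.ofReal ((1 + ∑ i, z i ^ 2) ^ (-((Fintype.card ι : ℝ) + 1) / 2))) z := by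
      refine lintegral_congr fun z => ?_
      by_cases hzs : z ∈ s
      · simp only [Set.indicator_of_mem hzs, Pi.one_apply, one_mul]
        rw [lintegral_abs_det_mul_comp_sum_sq_add hF z, mul_comm]
      · simp [Set.indicator_of_notMem hzs]
    _ = _ := by
      rw [lintegral_indicator hs, lintegral_const_mul _ (by fun_prop)]

end LebesgueMatrix

theorem volume_preserving_splitLastColumn (m n : ℕ) :
    MeasurePreserving fun A : Fin m → Fin (n + 1) → ℝ =>
      ((fun i j => A i j.castSucc : Fin m → Fin n → ℝ), fun i => A i (Fin.last n)) := by
  have h1 := volume_preserving_pi fun _ : Fin m =>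
    volume_preserving_piFinSuccAbove (fun _ : Fin (n + 1) => ℝ) (Fin.last n)
  have h2 := (volume_measurePreserving_arrowProdEquivProdArrow ℝ (Fin n → ℝ) (Fin m)).comp h1
  convert Measure.measurePreserving_swap.comp h2 using 1
  · ext A i j
    · simp [MeasurableEquiv.arrowProdEquivProdArrow, Equiv.arrowProdEquivProdArrow,
        MeasurableEquiv.piFinSuccAbove, Fin.init]
    · simp [MeasurableEquiv.arrowProdEquivProdArrow, Equiv.arrowProdEquivProdArrow,
        MeasurableEquiv.piFinSuccAbove]
  · exact Measure.volume_eq_prod _ _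

theorem of_submatrix_id_castSucc {m n : ℕ} (A : Fin m → Fin (n + 1) → ℝ) :
    (Matrix.of A).submatrix id Fin.castSucc = Matrix.of fun i j => A i j.castSucc := by
  ext
  rfl

theorem measurable_inv_submatrix_castSucc_mulVec_last (m : ℕ) :
    Measurable fun A : Fin m → Fin (m + 1) → ℝ =>
      ((Matrix.of A).submatrix id Fin.castSucc)⁻¹ *ᵥ fun i => A i (Fin.last m) := by
  simp only [of_submatrix_id_castSucc]
  have h := (measurable_inv_of_mulVec (ι := Fin m)).comp
    (volume_preserving_splitLastColumn m m).measurable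
  simp only [Function.comp_def] at h
  exact h

theorem map_withDensity_inv_submatrix_mulVec_apply {m : ℕ} {F : ℝ → ℝ≥0∞} (hF : Measurable F)
    {s : Set (Fin m → ℝ)} (hs : MeasurableSet s) :
    ((volume : Measure (Fin m → Fin (m + 1) → ℝ)).withDensity fun A =>
        F (Matrix.trace (Matrix.of A * (Matrix.of A)ᵀ))).map
        (fun A => ((Matrix.of A).submatrix id Fin.castSucc)⁻¹ *ᵥ fun i => A i (Fin.last m)) s =
      (∫⁻ C : Fin m → Fin m → ℝ,
          ENNReal.ofReal |(Matrix.of C).det| * F (∑ i, ∑ j, C i j ^ 2)) *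
        ∫⁻ z in s, ENNReal.ofReal ((1 + ∑ i, z i ^ 2) ^ (-((m : ℝ) + 1) / 2)) := by
  have hT := measurable_inv_submatrix_castSucc_mulVec_last m
  have h := lintegral_indicator_inv_mulVec hF hs
  rw [Fintype.card_fin] at h
  have hmeas : Measurable fun p : (Fin m → Fin m → ℝ) × (Fin m → ℝ) =>
      s.indicator (1 : (Fin m → ℝ) → ℝ≥0∞) ((Matrix.of p.1)⁻¹ *ᵥ p.2) *
        F ((∑ i, ∑ j, p.1 i j ^ 2) + ∑ i, p.2 i ^ 2) :=
    ((measurable_one.indicator hs).comp measurable_inv_of_mulVec).mul (hF.comp (by fun_prop))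
  rw [← h, ← (volume_preserving_splitLastColumn m m).lintegral_comp hmeas,
    Measure.map_apply hT hs, withDensity_apply _ (hT hs), ← lintegral_indicator (hT hs)]
  refine lintegral_congr fun A => ?_
  have htr : (Matrix.of A * (Matrix.of A)ᵀ).trace =
      (∑ i, ∑ j : Fin m, A i j.castSucc ^ 2) + ∑ i, A i (Fin.last m) ^ 2 := by
    simp [Matrix.trace, Matrix.mul_apply, ← sq, Fin.sum_univ_castSucc, Finset.sum_add_distrib]
  rw [← htr, ← of_submatrix_id_castSucc]
  by_cases hA : ((Matrix.of A).submatrix id Fin.castSucc)⁻¹ *ᵥ (fun i => A i (Fin.last m)) ∈ s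
  · rw [Set.indicator_of_mem hA, Pi.one_apply, one_mul]
    exact Set.indicator_of_mem (a := A) (by exact hA) _
  · rw [Set.indicator_of_notMem hA, zero_mul]
    exact Set.indicator_of_notMem (a := A) (by exact hA) _

/-- For `A = (B, x)` an `m × (m+1)` real random matrix with density `f(tr A Aᵀ)`,
the solution vector `z = B⁻¹x` follows the `m`-dimensional standard Cauchy
distribution, with density `(Γ((m+1)/2)/π^((m+1)/2)) (1 + zᵀz)^(−(m+1)/2)`,
independently of `f`. -/
theorem universality_Binv_vector_cauchy (m : ℕ) (hm : 1 ≤ m)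
    (f : ℝ → ℝ) (hf_meas : Measurable f) (hf_nonneg : ∀ x, 0 ≤ f x)
    (μ : Measure (Fin m → Fin (m + 1) → ℝ))
    (hμ : μ = volume.withDensity fun A =>
      ENNReal.ofReal (f (Matrix.trace (Matrix.of A * (Matrix.of A)ᵀ))))
    (hprob : IsProbabilityMeasure μ) :
    μ.map (fun A : Fin m → Fin (m + 1) → ℝ =>
        ((Matrix.of A).submatrix id Fin.castSucc)⁻¹ *ᵥ fun i => A i (Fin.last m))
      = volume.withDensity fun z : Fin m → ℝ =>
          ENNReal.ofReal
            (Real.Gamma ((m + 1 : ℝ) / 2) / Real.pi ^ ((m + 1 : ℝ) / 2) *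
              (1 + ∑ i, z i ^ 2) ^ (-((m : ℝ) + 1) / 2)) := by
  have hT := measurable_inv_submatrix_castSucc_mulVec_last m
  have hmap {s : Set (Fin m → ℝ)} (hs : MeasurableSet s) :=
    map_withDensity_inv_submatrix_mulVec_apply hf_meas.ennreal_ofReal hs
  rw [← hμ] at hmap
  generalize (∫⁻ C : Fin m → Fin m → ℝ, ENNReal.ofReal |(Matrix.of C).det| *
    ENNReal.ofReal (f (∑ i, ∑ j, C i j ^ 2))) = K at hmap
  have hΓ : 0 < Real.Gamma ((m + 1 : ℝ) / 2) := Real.Gamma_pos_of_pos (by positivity)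
  have hK : K = ENNReal.ofReal
      (Real.Gamma ((m + 1 : ℝ) / 2) / π ^ ((m + 1 : ℝ) / 2)) := by
    have h := hmap .univ
    have hJ := lintegral_ofReal_one_add_sum_sq_rpow (ι := Fin m)
    rw [Fintype.card_fin] at hJ
    rw [Measure.map_apply hT .univ, Set.preimage_univ, measure_univ, Measure.restrict_univ, hJ] at h
    rw [← inv_div, ENNReal.ofReal_inv_of_pos (by positivity)]
    exact ENNReal.eq_inv_of_mul_eq_one_left h.symm
  ext s hs
  rw [hmap hs, withDensity_apply _ hs, hK, ← lintegral_const_mul _ (by fun_prop)]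
  refine lintegral_congr fun z => ?_
  rw [← ENNReal.ofReal_mul (by positivity)]
end
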